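/- arXiv:2410.09800 — 10 statements merged into one kernel-verified Lean document; each statement's English description precedes it below -/
import Mathlib

section
/- Let m and s be positive integers with m ≤ s, and let A be the m × m matrix with real entries A_{ℓ,k} = 1/(s − ℓ + k)! for ℓ, k ∈ {1, …, m}. Then det A = (∏_{k=1}^{m} (m − k)!) / (∏_{ℓ=1}^{m} (s + m − ℓ)!). -/
open scoped BigOperators

/-- Reindexing a product over `1 ≤ k ≤ m` by `i = m - k`. -/
theorem prod_Icc_one_sub {M : Type*} [CommMonoid M] (m : ℕ) (f : ℕ → M) :
    ∏ k ∈ Finset.Icc 1 m, f (m - k) = ∏ i : Fin m, f i := by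
  rw [Fin.prod_univ_eq_prod_range]
  refine Finset.prod_nbij' (fun k => m - k) (fun i => m - i) ?_ ?_ ?_ ?_ ?_ <;>
    simp only [Finset.mem_Icc, Finset.mem_range, implies_true] <;> omega

theorem det_vandermonde_nat_add (m s : ℕ) :
    (Matrix.vandermonde fun i : Fin m => ((s + i : ℕ) : ℝ)).det =
      ∏ i : Fin m, ((i : ℕ).factorial : ℝ) := by
  have h : (fun i : Fin m => ((s + i : ℕ) : ℝ)) = fun i : Fin m => ((i : ℕ) : ℝ) + s := by
    funext i
    push_cast
    ring
  rw [h, Matrix.det_vandermonde_add]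
  cases m with
  | zero => simp
  | succ n =>
    rw [Matrix.det_vandermonde_id_eq_superFactorial,
      Fin.prod_univ_eq_prod_range fun i => (i.factorial : ℝ), ← Nat.cast_prod,
      Nat.prod_range_succ_factorial]

/-- The determinant of the reciprocal factorials `1 / (s + i - j)!`. -/
theorem det_one_div_factorial_add_sub (m s : ℕ) (hms : m ≤ s) :
    (Matrix.of fun i j : Fin m => (1 : ℝ) / ((s + i.1 - j.1).factorial : ℝ)).det =
      (∏ i : Fin m, ((i : ℕ).factorial : ℝ)) / ∏ i : Fin m, ((s + i).factorial : ℝ) := by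
  have h : (Matrix.of fun i j : Fin m => (1 : ℝ) / ((s + i.1 - j.1).factorial : ℝ)) =
      Matrix.of fun i j : Fin m => (((s + i).factorial : ℝ))⁻¹ *
        (Matrix.of fun i j : Fin m =>
          (descPochhammer ℝ j).eval (((s + i : ℕ) : ℝ))) i j := by
    ext i j
    have hij : j.1 ≤ s + i.1 := by omega
    simp only [Matrix.of_apply]
    rw [descPochhammer_eval_eq_descFactorial, ← Nat.factorial_mul_descFactorial hij]
    have h₁ : ((s + i.1 - j.1).factorial : ℝ) ≠ 0 := by positivity
    have h₂ : ((s + i.1).descFactorial j.1 : ℝ) ≠ 0 := by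
      exact_mod_cast (Nat.descFactorial_pos.2 hij).ne'
    push_cast
    field_simp
  rw [h, Matrix.det_mul_column,
    ← Matrix.det_eval_matrixOfPolynomials_eq_det_vandermonde _
      (fun j : Fin m => descPochhammer ℝ j) (fun j => descPochhammer_natDegree ℝ j)
      (fun j => monic_descPochhammer ℝ j),
    det_vandermonde_nat_add, Finset.prod_inv_distrib, div_eq_inv_mul]

/-- Lemma B.1 of the paper: the determinant of the `m × m` matrix with entries
`A_{ℓ,k} = 1/(s − ℓ + k)!` (for `ℓ, k ∈ {1, …, m}`, with `m ≤ s`) equals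
`(∏_{k=1}^{m} (m − k)!) / (∏_{ℓ=1}^{m} (s + m − ℓ)!)`. -/
theorem stmt0 (m s : ℕ) (hm : 0 < m) (hms : m ≤ s) :
    Matrix.det (Matrix.of fun ℓ k : Fin m =>
      (1 : ℝ) / ((s - (ℓ.1 + 1) + (k.1 + 1)).factorial : ℝ)) =
    (∏ k ∈ Finset.Icc 1 m, ((m - k).factorial : ℝ)) /
      (∏ ℓ ∈ Finset.Icc 1 m, ((s + m - ℓ).factorial : ℝ)) := by
  rw [prod_Icc_one_sub m fun i => (i.factorial : ℝ)]
  have h : ∏ ℓ ∈ Finset.Icc 1 m, ((s + m - ℓ).factorial : ℝ) =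
      ∏ i : Fin m, ((s + i).factorial : ℝ) := by
    rw [← prod_Icc_one_sub m fun i => ((s + i).factorial : ℝ)]
    refine Finset.prod_congr rfl fun k hk => ?_
    rw [Nat.add_sub_assoc (Finset.mem_Icc.1 hk).2]
  rw [h, ← det_one_div_factorial_add_sub m s hms, ← Matrix.det_submatrix_equiv_self Fin.revPerm]
  congr 1
  ext i j
  simp only [Matrix.submatrix_apply, Matrix.of_apply, Fin.revPerm_apply, Fin.val_rev]
  congr 3
  omega
end

section
/- Let m be a positive integer and t an integer with t ≥ −1, and let A be the m × m matrix with real entries A_{r,s} = (r + s + t − 1)! for r, s ∈ {1, …, m}. Then det A = (∏_{s=1}^{m} (s + t)!) · (∏_{r=1}^{m} (r − 1)!). -/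
open scoped BigOperators

/-- The determinant of the Hankel matrix of the factorials `(i + j + k)!`. -/
theorem det_factorial_add_add (R : Type*) [CommRing R] [IsDomain R] (n k : ℕ) :
    (Matrix.of fun i j : Fin (n + 1) => ((i.1 + j.1 + k).factorial : R)).det =
      (∏ i ∈ Finset.range (n + 1), ((i + k).factorial : R)) *
        ∏ i ∈ Finset.range (n + 1), (i.factorial : R) := by
  have hentry : (Matrix.of fun i j : Fin (n + 1) => ((i.1 + j.1 + k).factorial : R)) =
      Matrix.of fun i j : Fin (n + 1) => ((i.1 + k).factorial : R) *
        (Matrix.of fun i j : Fin (n + 1) =>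
          (ascPochhammer R j).eval ((i : R) + ((k : R) + 1))) i j := by
    ext i j
    have h := factorial_mul_ascPochhammer R (i.1 + k) j
    rw [Nat.cast_add, add_assoc] at h
    rw [Matrix.of_apply, Matrix.of_apply, Matrix.of_apply, h, add_right_comm]
  rw [hentry, Matrix.det_mul_column,
    ← Matrix.det_eval_matrixOfPolynomials_eq_det_vandermonde _ _
      (fun j => ascPochhammer_natDegree R j.1) (fun j => monic_ascPochhammer R j.1),
    Matrix.det_vandermonde_add, Matrix.det_vandermonde_id_eq_superFactorial,
    Fin.prod_univ_eq_prod_range (fun i => ((i + k).factorial : R)),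
    ← Nat.prod_range_succ_factorial, Nat.cast_prod]

/-- Lemma B.2 of the paper: for `t ≥ −1`, the determinant of the `m × m` matrix with entries
`A_{r,s} = (r + s + t − 1)!` (for `r, s ∈ {1, …, m}`) equals
`(∏_{s=1}^{m} (s + t)!) · (∏_{r=1}^{m} (r − 1)!)`. -/
theorem stmt1 (m : ℕ) (hm : 0 < m) (t : ℤ) (ht : -1 ≤ t) :
    Matrix.det (Matrix.of fun r s : Fin m =>
      ((((r.1 + 1 : ℤ) + (s.1 + 1) + t - 1).toNat.factorial : ℕ) : ℝ)) =
    (∏ s ∈ Finset.Icc 1 m, ((((s : ℤ) + t).toNat.factorial : ℕ) : ℝ)) *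
      (∏ r ∈ Finset.Icc 1 m, ((r - 1).factorial : ℝ)) := by
  obtain ⟨n, rfl⟩ := Nat.exists_eq_succ_of_ne_zero hm.ne'
  obtain ⟨k, hk⟩ := Int.eq_ofNat_of_zero_le (show 0 ≤ t + 1 by lia)
  obtain rfl : t = k - 1 := by lia
  convert det_factorial_add_add ℝ n k using 2
  · ext r s
    simp only [Matrix.of_apply]
    congr 2
    omega
  · rw [← Finset.Ico_add_one_right_eq_Icc, Finset.prod_Ico_eq_prod_range]
    refine Finset.prod_congr (by simp) fun i _ => ?_
    congr 2
    lia
  · rw [← Finset.Ico_add_one_right_eq_Icc, Finset.prod_Ico_eq_prod_range]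
    simp
end

section
/- For all integers m ≥ 1 and t ≥ −1, the m × m matrix with entries B_{r,s} = binom(r + s + t − 1, r − 1) for r, s ∈ {1, …, m} has determinant equal to 1. -/
open scoped BigOperators

/-- Vandermonde's convolution, with the summation range extended to any `m > r`. -/
lemma choose_add_add_eq_sum_fin (m k r s : ℕ) (hr : r < m) :
    (s + (r + k)).choose r =
      ∑ j : Fin m, (if j.1 ≤ r then (r + k).choose (r - j) else 0) * s.choose j := by
  rw [Nat.add_choose_eq, Finset.Nat.sum_antidiagonal_eq_sum_range_succ_mk,
    Fin.sum_univ_eq_sum_range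
      (fun j => (if j ≤ r then (r + k).choose (r - j) else 0) * s.choose j) m,
    ← Finset.sum_subset (Finset.range_subset_range.2 (Nat.succ_le_of_lt hr))]
  · refine Finset.sum_congr rfl fun j hj => ?_
    rw [if_pos (Nat.lt_succ_iff.1 (Finset.mem_range.1 hj)), mul_comm]
  · intro j _ hj
    rw [if_neg (by simpa using hj), zero_mul]

/-- The matrix with entries `binom(r + s + k, r)`, `0 ≤ r, s < m`, has determinant `1`. -/
lemma det_choose_add_add {R : Type*} [CommRing R] (m k : ℕ) :
    Matrix.det (Matrix.of fun r s : Fin m => (((s.1 + (r.1 + k)).choose r : ℕ) : R)) = 1 := by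
  let L : Matrix (Fin m) (Fin m) R := Matrix.of fun r j =>
    ((if j.1 ≤ r.1 then (r.1 + k).choose (r.1 - j.1) else 0 : ℕ) : R)
  let U : Matrix (Fin m) (Fin m) R := Matrix.of fun j s => ((s.1.choose j.1 : ℕ) : R)
  have hLU : (Matrix.of fun r s : Fin m => (((s.1 + (r.1 + k)).choose r : ℕ) : R)) = L * U := by
    ext r s
    simp only [L, U, Matrix.mul_apply, Matrix.of_apply]
    rw [choose_add_add_eq_sum_fin m k r s r.2, Nat.cast_sum]
    exact Finset.sum_congr rfl fun j _ => Nat.cast_mul _ _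
  have hL : L.det = 1 := by
    rw [Matrix.det_of_isLowerTriangular]
    · simp [L]
    · intro i j hij
      have hij : i < j := hij
      simp [L, hij.not_ge]
  have hU : U.det = 1 := by
    rw [Matrix.det_of_isUpperTriangular]
    · simp [U]
    · intro i j hij
      have hij : j.1 < i.1 := hij
      simp [U, Nat.choose_eq_zero_of_lt hij]
  rw [hLU, Matrix.det_mul, hL, hU, one_mul]

/-- The key intermediate claim in the proof of Lemma B.2 of the paper: for `t ≥ −1`, the
`m × m` matrix with entries `B_{r,s} = binom(r + s + t − 1, r − 1)` has determinant `1`. -/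
theorem stmt3 (m : ℕ) (hm : 1 ≤ m) (t : ℤ) (ht : -1 ≤ t) :
    Matrix.det (Matrix.of fun r s : Fin m =>
      ((Nat.choose ((r.1 + 1 : ℤ) + (s.1 + 1) + t - 1).toNat ((r.1 + 1) - 1) : ℕ) : ℝ)) = 1 := by
  obtain ⟨k, hk⟩ := Int.eq_ofNat_of_zero_le (show 0 ≤ t + 1 by linarith)
  rw [← det_choose_add_add (R := ℝ) m k]
  congr 2
  ext r s
  rw [Nat.add_sub_cancel,
    show ((r.1 + 1 : ℤ) + (s.1 + 1) + t - 1).toNat = s.1 + (r.1 + k) by omega]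
end

section
/- Let N ≥ 1, let β = {{a_1, b_1}, …, {a_N, b_N}} be any partition of {1, …, 2N} into N two-element blocks, and let x_1, …, x_{2N} ∈ ℝ be pairwise distinct. Let a, b, c, d ∈ ℝ with ad − bc ≠ 0, set φ(u) = (a u + b)/(c u + d) and φ'(u) = (ad − bc)/(c u + d)², and suppose c x_i + d ≠ 0 for all i ∈ {1, …, 2N}. Then the values φ(x_1), …, φ(x_{2N}) are pairwise distinct and det( 1/(π (x_{a_k} − x_{b_ℓ})²) )_{k,ℓ=1}^{N} = (∏_{i=1}^{2N} φ'(x_i)) · det( 1/(π (φ(x_{a_k}) − φ(x_{b_ℓ}))²) )_{k,ℓ=1}^{N}. -/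
open scoped BigOperators

/-- The difference of two values of a Möbius map. -/
theorem moebius_sub_moebius {A B C D u v : ℝ} (hu : C * u + D ≠ 0) (hv : C * v + D ≠ 0) :
    (A * u + B) / (C * u + D) - (A * v + B) / (C * v + D) =
      (A * D - B * C) * (u - v) / ((C * u + D) * (C * v + D)) := by
  rw [div_sub_div _ _ hu hv]
  congr 1
  ring

/-- Möbius covariance of the Brownian excursion kernel, with conformal weight `1` at each point. -/
theorem excursionKernel_moebius {A B C D u v : ℝ} (h : A * D - B * C ≠ 0)
    (hu : C * u + D ≠ 0) (hv : C * v + D ≠ 0) :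
    1 / (Real.pi * (u - v) ^ 2) =
      (A * D - B * C) / (C * u + D) ^ 2 * ((A * D - B * C) / (C * v + D) ^ 2 *
        (1 / (Real.pi * ((A * u + B) / (C * u + D) - (A * v + B) / (C * v + D)) ^ 2))) := by
  rw [moebius_sub_moebius hu hv]
  rcases eq_or_ne u v with rfl | huv
  · simp
  have huv' : u - v ≠ 0 := sub_ne_zero.mpr huv
  generalize A * D - B * C = J at h
  generalize C * u + D = p at hu
  generalize C * v + D = q at hv
  generalize u - v = w at huv'
  field_simp

/-- Möbius covariance of the Fomin-type determinants with Brownian excursion kernel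
`𝒦(u,v) = 1/(π (u − v)²)`: the unfused case (all valences equal to `1`) of property (COV)
of Theorem 1.3 of the paper. The pairing `β` of `{1, …, 2N}` is encoded by two endpoint
functions `a b : Fin N → Fin (2N)` which together enumerate all of `{1, …, 2N}`. -/
theorem stmt5 (N : ℕ) (hN : 1 ≤ N)
    (a b : Fin N → Fin (2 * N))
    (hpart : Function.Bijective (Sum.elim a b))
    (x : Fin (2 * N) → ℝ) (hx : Function.Injective x)
    (A B C D : ℝ) (h : A * D - B * C ≠ 0)
    (hden : ∀ i, C * x i + D ≠ 0) :
    Function.Injective (fun i => (A * x i + B) / (C * x i + D)) ∧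
    Matrix.det (Matrix.of fun k ℓ : Fin N =>
        1 / (Real.pi * (x (a k) - x (b ℓ)) ^ 2)) =
      (∏ i : Fin (2 * N), (A * D - B * C) / (C * x i + D) ^ 2) *
        Matrix.det (Matrix.of fun k ℓ : Fin N =>
          1 / (Real.pi * ((A * x (a k) + B) / (C * x (a k) + D) -
            (A * x (b ℓ) + B) / (C * x (b ℓ) + D)) ^ 2)) := by
  constructor
  · intro i j hij
    have hij' := sub_eq_zero.mpr hij
    rw [moebius_sub_moebius (hden i) (hden j), div_eq_zero_iff] at hij'
    simp only [mul_eq_zero, h, hden i, hden j, false_or, or_false, sub_eq_zero] at hij'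
    exact hx hij'
  · rw [← (Equiv.ofBijective _ hpart).prod_comp, Fintype.prod_sum_type, mul_assoc,
      ← Matrix.det_mul_row, ← Matrix.det_mul_column]
    congr 1
    ext k l
    exact excursionKernel_moebius h (hden (a k)) (hden (b l))
end

section
/- Let N ≥ 1 and let x_1, …, x_N, y ∈ ℝ with y ≠ x_i for all i. Then det( ((−1)^{N−j} (N − j + 1)!) / (π (y − x_i)^{N−j+2}) )_{i,j=1}^{N} = (1/π^N) · ∏_{k=1}^{N} ( k! / (y − x_k)^{N+1} ) · ∏_{1 ≤ i < j ≤ N} (x_j − x_i). -/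
open scoped BigOperators

/-- The explicit determinant evaluation of Appendix C.2 of the paper (equation (C.1)):
the pure partition function of the fused rainbow (half-watermelon) pattern.
The `(i,j)` entry is the `(N − j)`-th derivative in `y` of the Brownian excursion kernel
`1/(π (y − x_i)²)`; here `j ∈ {1, …, N}` is represented by `j.1 + 1` for `j : Fin N`. -/
theorem stmt6 (N : ℕ) (hN : 1 ≤ N) (x : Fin N → ℝ) (y : ℝ) (hy : ∀ i, y ≠ x i) :
    Matrix.det (Matrix.of fun i j : Fin N =>
      ((-1 : ℝ) ^ (N - 1 - j.1) * ((N - j.1).factorial : ℝ)) /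
        (Real.pi * (y - x i) ^ (N - j.1 + 1))) =
    (1 / Real.pi ^ N) *
      (∏ k : Fin N, ((k.1 + 1).factorial : ℝ) / (y - x k) ^ (N + 1)) *
      (∏ i : Fin N, ∏ j ∈ Finset.Ioi i, (x j - x i)) := by
  have hu : ∀ i, y - x i ≠ 0 := fun i => sub_ne_zero.mpr (hy i)
  have hM : (Matrix.of fun i j : Fin N =>
      ((-1 : ℝ) ^ (N - 1 - j.1) * ((N - j.1).factorial : ℝ)) /
        (Real.pi * (y - x i) ^ (N - j.1 + 1))) =
      Matrix.of fun i j : Fin N => ((-1) ^ (N - 1) / (Real.pi * (y - x i) ^ (N + 1))) *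
        (Matrix.of fun i j : Fin N => ((N - j.1).factorial : ℝ) *
          Matrix.vandermonde (fun i => x i - y) i j) i j := by
    ext i j
    obtain ⟨m, hm⟩ : ∃ m, N = m + 1 + j.1 := ⟨N - 1 - j.1, by omega⟩
    have hsub : N - j.1 = m + 1 := by omega
    have hsub' : N - 1 - j.1 = m := by omega
    have hsub'' : N - 1 = m + j.1 := by omega
    have hsucc : N + 1 = m + 1 + 1 + j.1 := by omega
    have hi := hu i
    have hsign : (-1 : ℝ) ^ j.1 * (x i - y) ^ j.1 = (y - x i) ^ j.1 := by
      rw [← mul_pow]; congr 1; ring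
    simp only [Matrix.of_apply, Matrix.vandermonde_apply]
    rw [hsub, hsub', hsub'', hsucc, div_mul_eq_mul_div,
      div_eq_div_iff (by positivity) (by positivity), pow_add (y - x i) (m + 1 + 1), ← hsign]
    ring
  have hsign : ((-1 : ℝ) ^ (N - 1)) ^ N = 1 := by
    rw [← pow_mul, mul_comm]
    exact (Nat.even_mul_pred_self N).neg_one_pow
  have hfact : ∏ j : Fin N, ((N - j.1).factorial : ℝ) = ∏ j : Fin N, ((j.1 + 1).factorial : ℝ) := by
    rw [← Equiv.prod_comp Fin.revPerm]
    refine Finset.prod_congr rfl fun j _ => ?_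
    rw [Fin.revPerm_apply, Fin.val_rev]
    congr 2
    omega
  rw [hM, Matrix.det_mul_column, Matrix.det_mul_row, Matrix.det_vandermonde, hfact]
  simp only [Finset.prod_div_distrib, Finset.prod_mul_distrib, Finset.prod_const,
    Finset.card_univ, Fintype.card_fin, hsign, sub_sub_sub_cancel_right]
  ring
end

section
/- Let N ≥ 1 and define Z on the open chamber {(x_1, …, x_N, y) ∈ ℝ^{N+1} : x_1 < ⋯ < x_N < y} by Z(x_1, …, x_N, y) = (1/π^N) · ∏_{k=1}^{N} ( k! / (y − x_k)^{N+1} ) · ∏_{1 ≤ i < j ≤ N} (x_j − x_i). Then for every j ∈ {1, …, N}, on the whole chamber: ∂²Z/∂x_j² + Σ_{i=1, i≠j}^{N} ( (2/(x_i − x_j)) ∂Z/∂x_i − (2/(x_i − x_j)²) Z ) + (2/(y − x_j)) ∂Z/∂y − (N(N+1)/(y − x_j)²) Z = 0. -/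
open scoped BigOperators

/-- The explicit pure partition function of the fused rainbow (half-watermelon) pattern
from Appendix C.2 of the paper: `Z(x, y) = (1/π^N) ∏_k k!/(y − x_k)^{N+1} ∏_{i<j} (x_j − x_i)`. -/
noncomputable def Zrainbow (N : ℕ) (p : (Fin N → ℝ) × ℝ) : ℝ :=
  (1 / Real.pi ^ N) *
    (∏ k : Fin N, ((k.1 + 1).factorial : ℝ) / (p.2 - p.1 k) ^ (N + 1)) *
    (∏ i : Fin N, ∏ j ∈ Finset.Ioi i, (p.1 j - p.1 i))

theorem hasDerivAt_prod_of_log {ι : Type*} (s : Finset ι) {f : ι → ℝ → ℝ} {g : ι → ℝ} {t : ℝ}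
    (h : ∀ i ∈ s, HasDerivAt (f i) (f i t * g i) t) :
    HasDerivAt (fun t => ∏ i ∈ s, f i t) ((∏ i ∈ s, f i t) * ∑ i ∈ s, g i) t := by
  classical
  refine (HasDerivAt.fun_finsetProd h).congr_deriv ?_
  rw [Finset.mul_sum]
  refine Finset.sum_congr rfl fun i hi => ?_
  rw [← Finset.mul_prod_erase s _ hi, smul_eq_mul]
  ring

/-- The derivative of `Zrainbow` along a curve in the chamber, in logarithmic form. -/
theorem hasDerivAt_Zrainbow_comp {N : ℕ} {c : ℝ → Fin N → ℝ} {e : ℝ → ℝ} {v : Fin N → ℝ} {w t : ℝ}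
    (hc : ∀ k, HasDerivAt (fun s => c s k) (v k) t) (he : HasDerivAt e w t)
    (hinj : Function.Injective (c t)) (hne : ∀ k, e t - c t k ≠ 0) :
    HasDerivAt (fun s => Zrainbow N (c s, e s))
      (Zrainbow N (c t, e t) * ((∑ k, (N + 1) * (v k - w) / (e t - c t k)) +
        ∑ i, ∑ k ∈ Finset.Ioi i, (v k - v i) / (c t k - c t i))) t := by
  have h₁ := hasDerivAt_prod_of_log (t := t) Finset.univ
    (f := fun k s => ((k.1 + 1).factorial : ℝ) / (e s - c s k) ^ (N + 1))
    (g := fun k : Fin N => (N + 1) * (v k - w) / (e t - c t k)) fun k _ => by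
      have hk := hne k
      refine ((hasDerivAt_const t ((k.1 + 1).factorial : ℝ)).fun_div
        ((he.fun_sub (hc k)).fun_pow (N + 1)) (pow_ne_zero _ hk)).congr_deriv ?_
      simp only [Nat.add_sub_cancel, Nat.cast_add, Nat.cast_one]
      field_simp
      ring
  have h₂ := hasDerivAt_prod_of_log (t := t) Finset.univ
    (f := fun i s => ∏ k ∈ Finset.Ioi i, (c s k - c s i))
    (g := fun i : Fin N => ∑ k ∈ Finset.Ioi i, (v k - v i) / (c t k - c t i)) fun i _ =>
      hasDerivAt_prod_of_log (Finset.Ioi i) fun k hk => by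
        have hk' : c t k - c t i ≠ 0 :=
          sub_ne_zero.2 (hinj.ne (Finset.mem_Ioi.1 hk).ne')
        rw [mul_div_cancel₀ _ hk']
        exact (hc k).fun_sub (hc i)
  refine ((h₁.const_mul (1 / Real.pi ^ N)).fun_mul h₂).congr_deriv ?_
  simp only [Zrainbow]
  ring

theorem sum_single_sub_single_div {N : ℕ} (x : Fin N → ℝ) (j : Fin N) :
    ∑ i, ∑ k ∈ Finset.Ioi i,
      ((Pi.single j 1 : Fin N → ℝ) k - (Pi.single j 1 : Fin N → ℝ) i) / (x k - x i) =
      ∑ k, 1 / (x j - x k) := by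
  have h₁ : ∑ i, ∑ k ∈ Finset.Ioi i, (Pi.single j 1 : Fin N → ℝ) k / (x k - x i) =
      ∑ k, if k < j then 1 / (x j - x k) else 0 := by
    refine Finset.sum_congr rfl fun i _ => ?_
    simp only [Pi.single_apply, ite_div, zero_div, Finset.sum_ite_eq', Finset.mem_Ioi]
  have h₂ : ∑ i, ∑ k ∈ Finset.Ioi i, (Pi.single j 1 : Fin N → ℝ) i / (x k - x i) =
      ∑ k, if j < k then 1 / (x k - x j) else 0 := by
    rw [Finset.sum_eq_single_of_mem j (Finset.mem_univ j) fun i _ hi => by simp [hi],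
      ← Finset.sum_filter, Finset.filter_lt_eq_Ioi]
    simp
  simp only [sub_div, Finset.sum_sub_distrib, h₁, h₂]
  rw [← Finset.sum_sub_distrib]
  refine Finset.sum_congr rfl fun k _ => ?_
  rcases lt_trichotomy k j with h | rfl | h
  · simp [h, h.not_gt]
  · simp
  · simp [h, h.not_gt, ← inv_neg]

theorem hasDerivAt_Zrainbow_update {N : ℕ} {x : Fin N → ℝ} {y : ℝ}
    (hinj : Function.Injective x) (hne : ∀ k, y - x k ≠ 0) (j : Fin N) :
    HasDerivAt (fun t => Zrainbow N (Function.update x j t, y))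
      (Zrainbow N (x, y) * ((N + 1) / (y - x j) + ∑ k, 1 / (x j - x k))) (x j) := by
  have h := hasDerivAt_Zrainbow_comp (c := Function.update x j) (e := fun _ => y)
    (fun k => hasDerivAt_pi.1 (hasDerivAt_update x j (x j)) k) (hasDerivAt_const (x j) y)
    (by simpa using hinj) (by simpa using hne)
  simp only [Function.update_eq_self, sum_single_sub_single_div] at h
  convert h using 3
  rw [Finset.sum_eq_single_of_mem j (Finset.mem_univ j) fun i _ hi => by simp [hi]]
  simp

theorem hasDerivAt_Zrainbow_snd {N : ℕ} {x : Fin N → ℝ} {y : ℝ}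
    (hinj : Function.Injective x) (hne : ∀ k, y - x k ≠ 0) :
    HasDerivAt (fun t => Zrainbow N (x, t))
      (Zrainbow N (x, y) * -((N + 1) * ∑ k, 1 / (y - x k))) y := by
  have h := hasDerivAt_Zrainbow_comp (c := fun _ => x) (fun k => hasDerivAt_const y (x k))
    (hasDerivAt_id' y) hinj hne
  convert h using 2
  simp only [sub_self, zero_div, Finset.sum_const_zero, add_zero, Finset.mul_sum,
    ← Finset.sum_neg_distrib]
  exact Finset.sum_congr rfl fun k _ => by ring

theorem injective_update {N : ℕ} {x : Fin N → ℝ} (hinj : Function.Injective x) {j : Fin N} {t : ℝ}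
    (ht : ∀ k, k ≠ j → t ≠ x k) : Function.Injective (Function.update x j t) := by
  intro a b hab
  by_cases ha : a = j <;> by_cases hb : b = j
  · rw [ha, hb]
  · subst ha
    simp only [Function.update_self, Function.update_of_ne hb] at hab
    exact absurd hab (ht b hb)
  · subst hb
    simp only [Function.update_self, Function.update_of_ne ha] at hab
    exact absurd hab.symm (ht a ha)
  · simp only [Function.update_of_ne ha, Function.update_of_ne hb] at hab
    exact hinj hab

theorem deriv_deriv_Zrainbow_update {N : ℕ} {x : Fin N → ℝ} {y : ℝ}
    (hinj : Function.Injective x) (hne : ∀ k, y - x k ≠ 0) (j : Fin N) :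
    deriv (deriv (fun t => Zrainbow N (Function.update x j t, y))) (x j) =
      Zrainbow N (x, y) * (((N + 1) / (y - x j) + ∑ k, 1 / (x j - x k)) ^ 2 +
        ((N + 1) / (y - x j) ^ 2 - ∑ k, 1 / (x j - x k) ^ 2)) := by
  have hx : ∀ k, k ≠ j → x j - x k ≠ 0 := fun k hk => sub_ne_zero.2 (hinj.ne hk.symm)
  have hev : deriv (fun t => Zrainbow N (Function.update x j t, y)) =ᶠ[nhds (x j)]
      fun t => Zrainbow N (Function.update x j t, y) *
        ((N + 1) / (y - t) + ∑ k ∈ Finset.univ.erase j, 1 / (t - x k)) := by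
    have h₁ : ∀ᶠ t in nhds (x j), ∀ k, k ≠ j → t ≠ x k := by
      refine Filter.eventually_all.2 fun k => ?_
      by_cases hk : k = j
      · simp [hk]
      · filter_upwards [eventually_ne_nhds (hinj.ne (Ne.symm hk))] with t ht _ using ht
    filter_upwards [h₁, eventually_ne_nhds (sub_ne_zero.1 (hne j)).symm] with t ht hty
    have h := hasDerivAt_Zrainbow_update (injective_update hinj ht) (y := y) (fun k => by
      by_cases hk : k = j
      · subst hk
        simpa using sub_ne_zero.2 hty.symm
      · simpa [hk] using hne k) j
    simp only [Function.update_idem, Function.update_self] at h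
    rw [h.deriv, ← Finset.add_sum_erase _ _ (Finset.mem_univ j), Function.update_self, sub_self,
      div_zero, zero_add]
    congr 2
    refine Finset.sum_congr rfl fun k hk => ?_
    rw [Function.update_of_ne (Finset.ne_of_mem_erase hk)]
  have hA : HasDerivAt
      (fun t => ((N : ℝ) + 1) / (y - t) + ∑ k ∈ Finset.univ.erase j, 1 / (t - x k))
      ((N + 1) / (y - x j) ^ 2 - ∑ k ∈ Finset.univ.erase j, 1 / (x j - x k) ^ 2) (x j) := by
    rw [sub_eq_add_neg, ← Finset.sum_neg_distrib]
    refine HasDerivAt.fun_add ?_ (HasDerivAt.fun_sum fun k hk => ?_)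
    · refine ((hasDerivAt_const (x j) ((N : ℝ) + 1)).fun_div
        ((hasDerivAt_id' (x j)).const_sub y) (hne j)).congr_deriv ?_
      ring
    · refine ((hasDerivAt_const (x j) (1 : ℝ)).fun_div ((hasDerivAt_id' (x j)).sub_const (x k))
        (hx k (Finset.ne_of_mem_erase hk))).congr_deriv ?_
      ring
  rw [hev.deriv_eq, ((hasDerivAt_Zrainbow_update hinj hne j).fun_mul hA).deriv,
    ← Finset.add_sum_erase _ (fun k => 1 / (x j - x k)) (Finset.mem_univ j),
    ← Finset.add_sum_erase _ (fun k => 1 / (x j - x k) ^ 2) (Finset.mem_univ j)]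
  simp only [Function.update_eq_self, sub_self, div_zero, zero_add, ne_eq, OfNat.ofNat_ne_zero,
    not_false_eq_true, zero_pow]
  ring

/-- Terms with a vanishing denominator contribute `0`, so all the sums may run over the whole
index type. -/
theorem sum_sum_div_sub {N : ℕ} {x : Fin N → ℝ} (hinj : Function.Injective x) (j : Fin N) :
    ∑ i, 2 / (x i - x j) * ∑ k, 1 / (x i - x k) =
      3 * (∑ k, 1 / (x j - x k) ^ 2) - (∑ k, 1 / (x j - x k)) ^ 2 := by
  have key : ∀ i k, 1 / (x i - x j) * (1 / (x i - x k)) + 1 / (x k - x j) * (1 / (x k - x i)) =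
      (if i = k then 1 / (x j - x k) ^ 2 else 0) + (if j = k then 1 / (x j - x i) ^ 2 else 0) +
        (if i = j then 1 / (x j - x k) ^ 2 else 0) - 1 / (x j - x i) * (1 / (x j - x k)) := by
    intro i k
    by_cases hij : i = j
    · subst hij
      by_cases hik : i = k
      · subst hik; simp
      · have h : x i - x k ≠ 0 := sub_ne_zero.2 (hinj.ne hik)
        rw [← neg_sub (x i) (x k)]
        simp only [sub_self, div_zero, zero_mul, zero_add, hik, if_false, if_true]
        field_simp
        ring
    by_cases hkj : j = k
    · subst hkj
      have h : x j - x i ≠ 0 := sub_ne_zero.2 (hinj.ne (Ne.symm hij))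
      rw [← neg_sub (x j) (x i)]
      simp only [sub_self, div_zero, zero_mul, mul_zero, hij, if_false, if_true]
      field_simp
      ring
    have h₁ : x j - x i ≠ 0 := sub_ne_zero.2 (hinj.ne (Ne.symm hij))
    have h₂ : x j - x k ≠ 0 := sub_ne_zero.2 (hinj.ne hkj)
    rw [← neg_sub (x j) (x i), ← neg_sub (x j) (x k)]
    by_cases hik : i = k
    · subst hik
      simp only [sub_self, div_zero, mul_zero, hij, hkj, if_false, if_true]
      field_simp
      ring
    have h₃ : x i - x k ≠ 0 := sub_ne_zero.2 (hinj.ne hik)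
    rw [← neg_sub (x i) (x k)]
    simp only [hij, hkj, hik, if_false]
    field_simp
    ring
  have hswap : ∑ i, ∑ k, 1 / (x i - x j) * (1 / (x i - x k)) =
      ∑ i, ∑ k, 1 / (x k - x j) * (1 / (x k - x i)) := Finset.sum_comm
  calc ∑ i, 2 / (x i - x j) * ∑ k, 1 / (x i - x k)
      = ∑ i, ∑ k, 1 / (x i - x j) * (1 / (x i - x k)) +
          ∑ i, ∑ k, 1 / (x i - x j) * (1 / (x i - x k)) := by
        rw [← two_mul, Finset.mul_sum]
        refine Finset.sum_congr rfl fun i _ => ?_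
        rw [← Finset.mul_sum]
        ring
    _ = ∑ i, ∑ k, (1 / (x i - x j) * (1 / (x i - x k)) +
          1 / (x k - x j) * (1 / (x k - x i))) := by
        nth_rewrite 2 [hswap]
        simp only [Finset.sum_add_distrib]
    _ = _ := by
        simp only [key, Finset.sum_add_distrib, Finset.sum_sub_distrib, sq (∑ k, 1 / (x j - x k)),
          Finset.sum_mul_sum, Finset.sum_ite_eq, Finset.mem_univ, if_true]
        rw [Finset.sum_comm (f := fun i k => if i = j then 1 / (x j - x k) ^ 2 else 0)]
        simp only [Finset.sum_ite_eq', Finset.mem_univ, if_true]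
        ring

theorem sum_div_mul_div {N : ℕ} {x : Fin N → ℝ} {y : ℝ} (hinj : Function.Injective x)
    (hne : ∀ k, y - x k ≠ 0) (j : Fin N) :
    ∑ i, 2 / (x i - x j) * ((N + 1) / (y - x i)) =
      2 * (N + 1) / (y - x j) * ((∑ k, 1 / (y - x k)) - 1 / (y - x j) - ∑ k, 1 / (x j - x k)) := by
  have h : 1 / (y - x j) = ∑ k, if j = k then 1 / (y - x k) else 0 := by simp
  rw [h, ← Finset.sum_sub_distrib, ← Finset.sum_sub_distrib, Finset.mul_sum]
  refine Finset.sum_congr rfl fun k _ => ?_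
  by_cases hk : j = k
  · subst hk; simp
  have h₁ : x j - x k ≠ 0 := sub_ne_zero.2 (hinj.ne hk)
  have h₂ := hne k
  have h₃ := hne j
  rw [← neg_sub (x j) (x k), if_neg hk]
  field_simp
  ring

/-- The second-order BPZ PDE at each unfused point `x_j` for the explicit fused rainbow
pure partition function (an instance of property (PDE) of Theorem 1.3 of the paper):
`∂²Z/∂x_j² + Σ_{i≠j} (2/(x_i−x_j) ∂Z/∂x_i − 2/(x_i−x_j)² Z)
  + 2/(y−x_j) ∂Z/∂y − N(N+1)/(y−x_j)² Z = 0` on the chamber `x_1 < ⋯ < x_N < y`. -/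
theorem stmt7 (N : ℕ) (hN : 1 ≤ N) (j : Fin N) (x : Fin N → ℝ) (y : ℝ)
    (hx : ∀ i k : Fin N, i < k → x i < x k) (hy : ∀ i, x i < y) :
    deriv (deriv (fun t => Zrainbow N (Function.update x j t, y))) (x j) +
      (∑ i ∈ Finset.univ.erase j,
        ((2 / (x i - x j)) * deriv (fun t => Zrainbow N (Function.update x i t, y)) (x i) -
          (2 / (x i - x j) ^ 2) * Zrainbow N (x, y))) +
      (2 / (y - x j)) * deriv (fun t => Zrainbow N (x, t)) y -
      ((N * (N + 1) : ℕ) : ℝ) / (y - x j) ^ 2 * Zrainbow N (x, y) = 0 := by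
  have hinj : Function.Injective x :=
    (show StrictMono x from fun i k hik => hx i k hik).injective
  have hne : ∀ k, y - x k ≠ 0 := fun k => (sub_pos.2 (hy k)).ne'
  have hsq : ∑ i, 2 / (x i - x j) ^ 2 = 2 * ∑ k, 1 / (x j - x k) ^ 2 := by
    rw [Finset.mul_sum]
    refine Finset.sum_congr rfl fun k _ => ?_
    rw [← neg_sub (x j) (x k), neg_sq]
    ring
  have hsum : ∑ i ∈ Finset.univ.erase j,
        ((2 / (x i - x j)) * deriv (fun t => Zrainbow N (Function.update x i t, y)) (x i) -
          (2 / (x i - x j) ^ 2) * Zrainbow N (x, y)) =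
      Zrainbow N (x, y) * (∑ i, 2 / (x i - x j) * ((N + 1) / (y - x i)) +
        ∑ i, 2 / (x i - x j) * ∑ k, 1 / (x i - x k) - ∑ i, 2 / (x i - x j) ^ 2) := by
    rw [Finset.sum_erase _ (by simp), ← Finset.sum_add_distrib, ← Finset.sum_sub_distrib,
      Finset.mul_sum]
    refine Finset.sum_congr rfl fun i _ => ?_
    rw [(hasDerivAt_Zrainbow_update hinj hne i).deriv]
    ring
  rw [hsum, deriv_deriv_Zrainbow_update hinj hne, (hasDerivAt_Zrainbow_snd hinj hne).deriv,
    sum_sum_div_sub hinj, sum_div_mul_div hinj hne, hsq]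
  push_cast
  generalize y - x j = u
  ring
end

section
/- Let N ≥ 1 and define Z on the open chamber {(x_1, …, x_N, y) ∈ ℝ^{N+1} : x_1 < ⋯ < x_N < y} by Z(x_1, …, x_N, y) = (1/π^N) · ∏_{k=1}^{N} ( k! / (y − x_k)^{N+1} ) · ∏_{1 ≤ i < j ≤ N} (x_j − x_i). For an integer m ≥ 1 define the first-order differential operator ℒ_{−m} acting on smooth functions f on the chamber by (ℒ_{−m} f)(x, y) = −Σ_{i=1}^{N} ( (x_i − y)^{1−m} ∂f/∂x_i + (1 − m)(x_i − y)^{−m} f ). Then Σ_{k=1}^{N+1} Σ_{m_1, …, m_k ≥ 1, m_1+⋯+m_k = N+1} ( (−2)^{N+1−k} (N!)² / ∏_{l=1}^{k−1} (m_1+⋯+m_l)(m_{l+1}+⋯+m_k) ) · (ℒ_{−m_1} ∘ ⋯ ∘ ℒ_{−m_k}) Z = 0 on the whole chamber. -/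
open scoped BigOperators

/-- The first-order operator `ℒ_{−m}` at the fused point `y`:
`(ℒ_{−m} f)(x, y) = −Σ_{i=1}^{N} ((x_i − y)^{1−m} ∂f/∂x_i + (1 − m)(x_i − y)^{−m} f)`. -/
noncomputable def Lop (N : ℕ) (m : ℕ) (f : (Fin N → ℝ) × ℝ → ℝ) :
    (Fin N → ℝ) × ℝ → ℝ :=
  fun p =>
    -∑ i : Fin N,
      ((p.1 i - p.2) ^ ((1 : ℤ) - (m : ℤ)) *
          deriv (fun t => f (Function.update p.1 i t, p.2)) (p.1 i) +
        (1 - (m : ℝ)) * (p.1 i - p.2) ^ (-(m : ℤ)) * f p)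

theorem Finset.Nat.sum_antidiagonalTuple_succ {M : Type*} [AddCommMonoid M] (k j : ℕ)
    (f : (Fin (k + 1) → ℕ) → M) :
    ∑ m ∈ Finset.Nat.antidiagonalTuple (k + 1) j, f m =
      ∑ p ∈ Finset.HasAntidiagonal.antidiagonal j, ∑ m ∈ Finset.Nat.antidiagonalTuple k p.2,
        f (Fin.cons p.1 m) := by
  rw [Finset.sum_sigma']
  refine Finset.sum_bij' (fun m _ => ⟨(m 0, ∑ i, Fin.tail m i), Fin.tail m⟩)
    (fun q _ => Fin.cons q.1.1 q.2) ?_ ?_ ?_ ?_ ?_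
  · intro m hm
    simpa [Finset.Nat.mem_antidiagonalTuple, Fin.sum_univ_succ, Fin.tail] using hm
  · rintro ⟨p, m⟩ h
    simp only [Finset.mem_sigma, Finset.HasAntidiagonal.mem_antidiagonal,
      Finset.Nat.mem_antidiagonalTuple] at h
    simp [Finset.Nat.mem_antidiagonalTuple, Fin.sum_univ_succ, h]
  · intro m _
    simp
  · rintro ⟨⟨a, b⟩, m⟩ h
    simp only [Finset.mem_sigma, Finset.HasAntidiagonal.mem_antidiagonal,
      Finset.Nat.mem_antidiagonalTuple] at h
    obtain ⟨-, rfl⟩ := h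
    simp
  · intro m _
    simp

section Compositions

variable {M : Type*} [AddCommGroup M] [Module ℝ M]

/-- The contribution of the compositions of `j` into `k` parts to the iterated solution of the
recursion `c j • v j = ∑ lam m • L m (v (j - m))` started at `v₀`. -/
noncomputable def compositionSum (L : ℕ → M →ₗ[ℝ] M) (lam c : ℕ → ℝ) (v₀ : M) (k j : ℕ) : M :=
  ∑ m ∈ Finset.Nat.antidiagonalTuple k j,
    ((∏ i, lam (m i)) *
      ∏ l ∈ Finset.Ico 1 k,
        (c (∑ i ∈ Finset.univ.filter (fun i : Fin k => l ≤ (i : ℕ)), m i))⁻¹) •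
      (List.ofFn m).foldr (fun a => L a) v₀

theorem compositionSum_one (L : ℕ → M →ₗ[ℝ] M) (lam c : ℕ → ℝ) (v₀ : M) (j : ℕ) :
    compositionSum L lam c v₀ 1 j = lam j • L j v₀ := by
  simp [compositionSum]

theorem compositionSum_succ (L : ℕ → M →ₗ[ℝ] M) (lam c : ℕ → ℝ) (v₀ : M) (k j : ℕ) :
    compositionSum L lam c v₀ (k + 2) j =
      ∑ p ∈ Finset.HasAntidiagonal.antidiagonal j,
        lam p.1 • L p.1 ((c p.2)⁻¹ • compositionSum L lam c v₀ (k + 1) p.2) := by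
  unfold compositionSum
  rw [Finset.Nat.sum_antidiagonalTuple_succ]
  refine Finset.sum_congr rfl fun p _ => ?_
  rw [Finset.smul_sum, map_sum, Finset.smul_sum]
  refine Finset.sum_congr rfl fun m hm => ?_
  have hm' := Finset.Nat.mem_antidiagonalTuple.mp hm
  have tail (l : ℕ) :
      ∑ i ∈ Finset.univ.filter (fun i : Fin (k + 2) => l + 1 ≤ (i : ℕ)),
        (Fin.cons p.1 m : Fin (k + 2) → ℕ) i =
      ∑ i ∈ Finset.univ.filter (fun i : Fin (k + 1) => l ≤ (i : ℕ)), m i := by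
    rw [Finset.sum_filter, Finset.sum_filter, Fin.sum_univ_succ]
    simp
  rw [Fin.prod_univ_succ, List.ofFn_succ, List.foldr_cons]
  simp only [Fin.cons_zero, Fin.cons_succ, map_smul, smul_smul]
  congr 1
  rw [Finset.prod_Ico_eq_prod_range, Finset.prod_Ico_eq_prod_range,
    show k + 2 - 1 = k + 1 by omega, Finset.prod_range_succ']
  simp only [Nat.add_sub_cancel, add_comm 1, tail]
  simp only [zero_le, Finset.filter_true, hm']
  ring

theorem compositionSum_zero (L : ℕ → M →ₗ[ℝ] M) (lam c : ℕ → ℝ) (v₀ : M) (k : ℕ)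
    (hlam : lam 0 = 0) : compositionSum L lam c v₀ (k + 1) 0 = 0 := by
  simp [compositionSum, Finset.Nat.antidiagonalTuple_zero_right, hlam]

theorem sum_compositionSum (L : ℕ → M →ₗ[ℝ] M) (lam c : ℕ → ℝ) (v : ℕ → M) (n : ℕ)
    (hlam : lam 0 = 0) (hc : ∀ j, 1 ≤ j → j < n → c j ≠ 0)
    (hrec : ∀ j, c j • v j = ∑ p ∈ Finset.HasAntidiagonal.antidiagonal j, lam p.1 • L p.1 (v p.2))
    (K j : ℕ) (hj : 1 ≤ j) (hjK : j ≤ K) (hjn : j ≤ n) :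
    ∑ k ∈ Finset.range K, compositionSum L lam c (v 0) (k + 1) j = c j • v j := by
  induction K generalizing j with
  | zero => omega
  | succ K ih =>
    rw [Finset.sum_range_succ', compositionSum_one, hrec]
    simp_rw [compositionSum_succ]
    rw [Finset.sum_comm]
    obtain ⟨i, rfl⟩ : ∃ i, j = i + 1 := ⟨j - 1, by omega⟩
    rw [Finset.Nat.sum_antidiagonal_succ', Finset.Nat.sum_antidiagonal_succ']
    simp only [compositionSum_zero _ _ _ _ _ hlam, smul_zero, map_zero, Finset.sum_const_zero,
      zero_add]
    rw [add_comm]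
    congr 1
    refine Finset.sum_congr rfl fun p hp => ?_
    rcases Nat.eq_zero_or_pos p.1 with h0 | h0
    · simp [h0, hlam]
    have hp' := Finset.HasAntidiagonal.mem_antidiagonal.mp hp
    rw [← Finset.smul_sum, ← map_sum, ← Finset.smul_sum,
      ih (p.2 + 1) (by omega) (by omega) (by omega),
      inv_smul_smul₀ (hc _ (by omega) (by omega))]

end Compositions

/-- The coefficientwise extension of a derivation to power series. -/
noncomputable def Derivation.powerSeries {R A : Type*} [CommRing R] [CommRing A] [Algebra R A]
    (D : Derivation R A A) : Derivation R (PowerSeries A) (PowerSeries A) :=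
  Derivation.mk'
    { toFun := fun f => PowerSeries.mk fun n => D (PowerSeries.coeff n f)
      map_add' := fun f g => by ext; simp
      map_smul' := fun r f => by ext; simp }
    (fun f g => by
      ext n
      simp only [LinearMap.coe_mk, AddHom.coe_mk, PowerSeries.coeff_mk, PowerSeries.coeff_mul,
        map_sum, Derivation.leibniz, smul_eq_mul, map_add, Finset.sum_add_distrib]
      congr 1
      rw [← Finset.Nat.sum_antidiagonal_swap]
      rfl)

@[simp]
theorem Derivation.coeff_powerSeries {R A : Type*} [CommRing R] [CommRing A] [Algebra R A]
    (D : Derivation R A A) (f : PowerSeries A) (n : ℕ) :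
    PowerSeries.coeff n (D.powerSeries f) = D (PowerSeries.coeff n f) := by
  simp [Derivation.powerSeries]

theorem Derivation.map_prod_of_eigen {R A ι : Type*} [CommRing R] [CommRing A] [Algebra R A]
    (D : Derivation R A A) (s : Finset ι) (f c : ι → A) (h : ∀ i ∈ s, D (f i) = c i * f i) :
    D (∏ i ∈ s, f i) = (∑ i ∈ s, c i) * ∏ i ∈ s, f i := by
  classical
  induction s using Finset.induction_on with
  | empty => simp
  | insert a s ha ih =>
    rw [Finset.prod_insert ha, Finset.sum_insert ha, Derivation.leibniz,
      ih fun i hi => h i (Finset.mem_insert_of_mem hi), h a (Finset.mem_insert_self a s)]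
    simp only [smul_eq_mul]
    ring

namespace RainbowBPZ

variable {N : ℕ}

/-- Power series in one variable with coefficients in the polynomials in `N` variables. -/
abbrev PolySeries (N : ℕ) : Type := PowerSeries (MvPolynomial (Fin N) ℝ)

/-- The signed powers of two in the Benoit–Saint-Aubin formula. -/
noncomputable def weight (m : ℕ) : ℝ := if m = 0 then 0 else (-2) ^ (m - 1)

/-- The Taylor coefficients of `√(1 + 2t)`. -/
noncomputable def sqrtCoeff : ℕ → ℝ
  | 0 => 1
  | k + 1 => (1 - 2 * k) / (k + 1) * sqrtCoeff k

/-- The power series `t Xᵢ / (1 + 2 t Xᵢ)`. -/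
noncomputable def logDer (i : Fin N) : PolySeries N :=
  PowerSeries.mk fun m => MvPolynomial.C (weight m) * MvPolynomial.X i ^ m

/-- The power series `√(1 + 2 t Xᵢ)`. -/
noncomputable def sqrtSeries (i : Fin N) : PolySeries N :=
  PowerSeries.mk fun m => MvPolynomial.C (sqrtCoeff m) * MvPolynomial.X i ^ m

/-- The variable `Xᵢ` as a constant power series. -/
noncomputable def var (i : Fin N) : PolySeries N :=
  PowerSeries.C (MvPolynomial.X i)

/-- The power series `1 + 2 t Xᵢ`. -/
noncomputable def denom (i : Fin N) : PolySeries N :=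
  1 + 2 * (PowerSeries.X * var i)

theorem denom_ne_zero (i : Fin N) : denom i ≠ 0 := by
  intro h
  have := congrArg PowerSeries.constantCoeff h
  simp [denom] at this

theorem denom_mul_logDer (i : Fin N) : denom i * logDer i = PowerSeries.X * var i := by
  have e : denom i * logDer i =
      logDer i + PowerSeries.C (2 * MvPolynomial.X i) * (PowerSeries.X * logDer i) := by
    simp only [denom, var, map_mul, map_ofNat]
    ring
  rw [e]
  ext1 n
  rcases n with _ | _ | n
  · simp [logDer, weight, var]
  · simp only [map_add, PowerSeries.coeff_C_mul, PowerSeries.coeff_succ_X_mul, var]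
    simp [logDer, weight]
  · simp only [map_add, PowerSeries.coeff_C_mul, PowerSeries.coeff_succ_X_mul, var]
    simp only [logDer, weight, PowerSeries.coeff_mk, pow_succ]
    simp [map_ofNat]
    ring

/-- The Euler operator `t d/dt`. -/
noncomputable def euler : Derivation (MvPolynomial (Fin N) ℝ)
    (PolySeries N) (PolySeries N) :=
  (PowerSeries.X : PolySeries N) • PowerSeries.derivative _

theorem coeff_euler (f : PolySeries N) (n : ℕ) :
    PowerSeries.coeff n (euler f) = (n : MvPolynomial (Fin N) ℝ) * PowerSeries.coeff n f := by
  cases n with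
  | zero => simp [euler]
  | succ n =>
    simp [euler, PowerSeries.coeff_succ_X_mul, PowerSeries.coeff_derivative, mul_comm]

theorem euler_C (p : MvPolynomial (Fin N) ℝ) : euler (PowerSeries.C p) = 0 := by
  simp [euler]

theorem euler_sqrtSeries (i : Fin N) : euler (sqrtSeries i) = logDer i * sqrtSeries i := by
  apply mul_left_cancel₀ (denom_ne_zero i)
  rw [← mul_assoc, denom_mul_logDer]
  have e : denom i * euler (sqrtSeries i) = euler (sqrtSeries i) +
      PowerSeries.C (2 * MvPolynomial.X i) * (PowerSeries.X * euler (sqrtSeries i)) := by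
    simp only [denom, var, map_mul, map_ofNat]
    ring
  have e' : PowerSeries.X * var i * sqrtSeries i =
      PowerSeries.C (MvPolynomial.X i) * (PowerSeries.X * sqrtSeries i) := by
    simp only [var]; ring
  rw [e, e']
  ext1 n
  rcases n with _ | n
  · rw [map_add, coeff_euler]
    simp
  · simp only [map_add, PowerSeries.coeff_C_mul, PowerSeries.coeff_succ_X_mul, coeff_euler]
    simp only [sqrtSeries, PowerSeries.coeff_mk, sqrtCoeff, pow_succ]
    have h : MvPolynomial.C (σ := Fin N) ((1 - 2 * (n : ℝ)) / (n + 1) * sqrtCoeff n) *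
          ((n : MvPolynomial (Fin N) ℝ) + 1) =
        (1 - 2 * (n : MvPolynomial (Fin N) ℝ)) * MvPolynomial.C (sqrtCoeff n) := by
      have : (1 - 2 * (n : MvPolynomial (Fin N) ℝ)) = MvPolynomial.C (1 - 2 * (n : ℝ)) := by
        simp [map_ofNat]
      rw [this, show ((n : MvPolynomial (Fin N) ℝ) + 1) = MvPolynomial.C ((n : ℝ) + 1) by simp,
        ← map_mul, ← map_mul]
      congr 1
      field_simp
    push_cast
    linear_combination (MvPolynomial.X i ^ n * MvPolynomial.X i) * h

theorem euler_logDer (i : Fin N) : euler (logDer i) = logDer i - 2 * logDer i ^ 2 := by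
  apply mul_left_cancel₀ (denom_ne_zero i)
  have hX : euler (PowerSeries.X * var i) = PowerSeries.X * var i := by
    simp [euler, var, Derivation.leibniz, mul_comm]
  have h := congrArg euler (denom_mul_logDer i)
  have hd : euler (denom i) = 2 * (PowerSeries.X * var i) := by
    rw [denom, map_add, two_mul, map_add, hX, Derivation.map_one_eq_zero, zero_add, ← two_mul]
  rw [Derivation.leibniz, hX, hd, smul_eq_mul, smul_eq_mul] at h
  linear_combination h - (1 - 2 * logDer i) * denom_mul_logDer i

/-- The derivation `∑ᵢ t Xᵢ² / (1 + 2 t Xᵢ) ∂ᵢ`. -/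
noncomputable def flow : Derivation ℝ (PolySeries N)
    (PolySeries N) :=
  ∑ i, (logDer i * var i) • (MvPolynomial.pderiv i).powerSeries

theorem flow_apply (f : PolySeries N) :
    flow f = ∑ i, logDer i * (var i * (MvPolynomial.pderiv i).powerSeries f) := by
  rw [flow, ← Derivation.coeFnAddMonoidHom_apply, map_sum, Finset.sum_apply]
  exact Finset.sum_congr rfl fun i _ => by simp [mul_assoc]

theorem flow_var (j : Fin N) : flow (var j) = logDer j * var j := by
  rw [flow_apply, Finset.sum_eq_single j]
  · have : (MvPolynomial.pderiv (R := ℝ) j).powerSeries (var j) = 1 := by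
      ext1 n
      rw [Derivation.coeff_powerSeries, var, PowerSeries.coeff_C, PowerSeries.coeff_one]
      split_ifs <;> simp
    rw [this, mul_one, mul_comm, mul_comm (var j)]
  · intro i _ hi
    have : (MvPolynomial.pderiv (R := ℝ) i).powerSeries (var j) = 0 := by
      ext1 n
      rw [Derivation.coeff_powerSeries, var, PowerSeries.coeff_C]
      split_ifs <;> simp [MvPolynomial.pderiv_X_of_ne hi.symm]
    simp [this]
  · simp

theorem flow_sqrtSeries (j : Fin N) : flow (sqrtSeries j) = logDer j ^ 2 * sqrtSeries j := by
  rw [flow_apply, Finset.sum_eq_single j]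
  · have : var j * (MvPolynomial.pderiv (R := ℝ) j).powerSeries (sqrtSeries j) =
        euler (sqrtSeries j) := by
      ext1 n
      rw [var, PowerSeries.coeff_C_mul, Derivation.coeff_powerSeries, coeff_euler, sqrtSeries,
        PowerSeries.coeff_mk]
      cases n with
      | zero => simp
      | succ n =>
        rw [MvPolynomial.pderiv_C_mul, Derivation.leibniz_pow, MvPolynomial.pderiv_X_self,
          smul_eq_mul, nsmul_eq_mul, Nat.add_sub_cancel]
        ring
    rw [this, euler_sqrtSeries]
    ring
  · intro i _ hi
    have : (MvPolynomial.pderiv (R := ℝ) i).powerSeries (sqrtSeries j) = 0 := by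
      ext1 n
      simp [sqrtSeries, Derivation.leibniz_pow, MvPolynomial.pderiv_X_of_ne hi.symm]
    simp [this]
  · simp

theorem flow_var_sub (i j : Fin N) :
    flow (var j - var i) =
      (logDer i + logDer j - 2 * (logDer i * logDer j)) * (var j - var i) := by
  apply mul_left_cancel₀ (denom_ne_zero i)
  apply mul_left_cancel₀ (denom_ne_zero j)
  rw [map_sub, flow_var, flow_var]
  have hi := denom_mul_logDer i
  have hj := denom_mul_logDer j
  have hi' : denom i = 1 + 2 * (PowerSeries.X * var i) := rfl
  have hj' : denom j = 1 + 2 * (PowerSeries.X * var j) := rfl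
  linear_combination (denom i * var j) * hj - (denom j * var i) * hi -
    (var j - var i) * (denom j * hi + denom i * hj - 2 * (denom j * logDer j) * hi -
      2 * (PowerSeries.X * var i) * hj) +
    PowerSeries.X * var i * var j * (hi' - hj')

/-- The product of the differences `Xⱼ - Xᵢ` over `i < j`. -/
noncomputable def vandermonde (N : ℕ) : MvPolynomial (Fin N) ℝ :=
  ∏ i : Fin N, ∏ j ∈ Finset.Ioi i, (MvPolynomial.X j - MvPolynomial.X i)

/-- The generating series `∏_{i<j} (Xⱼ - Xᵢ) ∏ᵢ √(1 + 2 t Xᵢ)`. -/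
noncomputable def genSeries (N : ℕ) : PolySeries N :=
  PowerSeries.C (vandermonde N) * ∏ i, sqrtSeries i

theorem euler_genSeries : euler (genSeries N) = (∑ i, logDer i) * genSeries N := by
  have h := (euler (N := N)).map_prod_of_eigen Finset.univ sqrtSeries logDer
    fun i _ => euler_sqrtSeries i
  rw [genSeries, Derivation.leibniz, h, euler_C]
  simp only [smul_eq_mul]
  ring

theorem sum_pairs (a : Fin N → PolySeries N) :
    ∑ i, ∑ j ∈ Finset.Ioi i, (a i + a j - 2 * (a i * a j)) =
      ((N : PolySeries N) - 1) * ∑ i, a i - (∑ i, a i) ^ 2 + ∑ i, a i ^ 2 := by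
  have key (F : Fin N → Fin N → PolySeries N)
      (hF : ∀ i j, F i j = F j i) :
      ∑ i, ∑ j, F i j = 2 * ∑ i, ∑ j ∈ Finset.Ioi i, F i j + ∑ i, F i i := by
    have h1 (i : Fin N) : ∑ j, F i j =
        ∑ j ∈ Finset.Ioi i, F i j + ∑ j ∈ Finset.Iio i, F i j + F i i := by
      rw [← Finset.sum_filter_add_sum_filter_not Finset.univ (fun j => i < j),
        ← Finset.sum_filter_add_sum_filter_not (Finset.univ.filter fun j => ¬ i < j)
          (fun j => j < i), Finset.filter_filter, Finset.filter_filter, add_assoc]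
      congr 1
      · exact Finset.sum_congr (by ext; simp) fun _ _ => rfl
      congr 1
      · exact Finset.sum_congr (by ext; simp; omega) fun _ _ => rfl
      · rw [show (Finset.univ.filter fun j => ¬ i < j ∧ ¬ j < i) = {i} by ext; simp; omega]
        simp
    have h2 : ∑ i, ∑ j ∈ Finset.Iio i, F i j = ∑ i, ∑ j ∈ Finset.Ioi i, F i j := by
      rw [Finset.sum_comm' (t' := Finset.univ) (s' := fun j => Finset.Ioi j) (by simp)]
      exact Finset.sum_congr rfl fun i _ => Finset.sum_congr rfl fun j _ => hF _ _
    simp_rw [h1, Finset.sum_add_distrib, h2]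
    ring
  have h := key (fun i j => a i + a j - 2 * (a i * a j)) fun i j => by ring
  have h' : ∑ i, ∑ j, (a i + a j - 2 * (a i * a j)) =
      2 * ((N : PolySeries N) * ∑ i, a i) - 2 * (∑ i, a i) ^ 2 := by
    simp only [Finset.sum_sub_distrib, Finset.sum_add_distrib, Finset.sum_const,
      Finset.card_univ, Fintype.card_fin, nsmul_eq_mul, ← Finset.mul_sum, ← Finset.sum_mul]
    ring
  have h'' : ∑ i, (a i + a i - 2 * (a i * a i)) = 2 * ∑ i, a i - 2 * ∑ i, a i ^ 2 := by
    rw [Finset.mul_sum, Finset.mul_sum, ← Finset.sum_sub_distrib]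
    exact Finset.sum_congr rfl fun i _ => by ring
  rw [h', h''] at h
  have two_ne : (2 : PolySeries N) ≠ 0 := fun h => by
    have := congrArg (fun f => MvPolynomial.constantCoeff (PowerSeries.constantCoeff f)) h
    simp [map_ofNat] at this
  apply mul_left_cancel₀ two_ne
  linear_combination -h

theorem flow_genSeries :
    flow (genSeries N) =
      (((N : PolySeries N) - 1) * ∑ i, logDer i - (∑ i, logDer i) ^ 2 + 2 * ∑ i, logDer i ^ 2) *
        genSeries N := by
  have hs := (flow (N := N)).map_prod_of_eigen Finset.univ sqrtSeries (fun i => logDer i ^ 2)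
    fun i _ => flow_sqrtSeries i
  have hv := (flow (N := N)).map_prod_of_eigen Finset.univ
    (fun i => ∏ j ∈ Finset.Ioi i, (var j - var i)) _
    fun i _ => (flow (N := N)).map_prod_of_eigen (Finset.Ioi i)
      (fun j => var j - var i) _ fun j _ => flow_var_sub i j
  have hV : PowerSeries.C (vandermonde N) = ∏ i : Fin N, ∏ j ∈ Finset.Ioi i, (var j - var i) := by
    simp [vandermonde, var, map_prod]
  rw [genSeries, Derivation.leibniz, hs, hV, hv, sum_pairs]
  simp only [smul_eq_mul]
  ring

theorem genSeries_equation :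
    ((N : PolySeries N) + 1) * euler (genSeries N) - euler (euler (genSeries N)) =
      flow (genSeries N) + (∑ i, logDer i) * genSeries N := by
  have h : euler (∑ i : Fin N, logDer i) = ∑ i, logDer i - 2 * ∑ i, logDer i ^ 2 := by
    simp only [map_sum, euler_logDer, Finset.sum_sub_distrib, ← Finset.mul_sum]
  rw [flow_genSeries, euler_genSeries, Derivation.leibniz, h, euler_genSeries]
  simp only [smul_eq_mul]
  ring

/-- The operator `∑ᵢ (Xᵢ^(m+1) ∂ᵢ + a Xᵢ^m)`. -/
noncomputable def wittOp (a : ℝ) (m : ℕ) :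
    MvPolynomial (Fin N) ℝ →ₗ[ℝ] MvPolynomial (Fin N) ℝ :=
  ∑ i, LinearMap.mulLeft ℝ (MvPolynomial.X i ^ m) ∘ₗ
    (LinearMap.mulLeft ℝ (MvPolynomial.X i) ∘ₗ (MvPolynomial.pderiv i).toLinearMap +
      a • LinearMap.id)

theorem wittOp_apply (a : ℝ) (m : ℕ) (q : MvPolynomial (Fin N) ℝ) :
    wittOp a m q = ∑ i, MvPolynomial.X i ^ m *
      (MvPolynomial.X i * MvPolynomial.pderiv i q + a • q) := by
  simp [wittOp]

theorem genSeries_recursion (j : ℕ) :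
    ((j : ℝ) * (N + 1 - j)) • PowerSeries.coeff j (genSeries N) =
      ∑ p ∈ Finset.HasAntidiagonal.antidiagonal j,
        weight p.1 • wittOp 1 p.1 (PowerSeries.coeff p.2 (genSeries N)) := by
  have h := congrArg (PowerSeries.coeff j) (genSeries_equation (N := N))
  have hN : ((N : PolySeries N) + 1) =
      PowerSeries.C ((N : MvPolynomial (Fin N) ℝ) + 1) := by simp
  have e : flow (genSeries N) + (∑ i, logDer i) * genSeries N = ∑ i, logDer i *
      (var i * (MvPolynomial.pderiv i).powerSeries (genSeries N) + genSeries N) := by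
    rw [flow_apply, Finset.sum_mul, ← Finset.sum_add_distrib]
    exact Finset.sum_congr rfl fun i _ => by ring
  rw [e, map_sub, hN, PowerSeries.coeff_C_mul, coeff_euler, coeff_euler, coeff_euler, map_sum] at h
  simp only [PowerSeries.coeff_mul _ (logDer _), map_add, var, PowerSeries.coeff_C_mul,
    Derivation.coeff_powerSeries] at h
  rw [Finset.sum_comm] at h
  have h1 : ((j : ℝ) * (N + 1 - j)) • PowerSeries.coeff j (genSeries N) =
      ((N : MvPolynomial (Fin N) ℝ) + 1) * (j * PowerSeries.coeff j (genSeries N)) -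
        j * (j * PowerSeries.coeff j (genSeries N)) := by
    rw [MvPolynomial.smul_eq_C_mul]
    simp only [map_mul, map_sub, map_add, map_one, map_natCast]
    ring
  rw [h1, h]
  refine Finset.sum_congr rfl fun p _ => ?_
  rw [wittOp_apply, Finset.smul_sum]
  refine Finset.sum_congr rfl fun i _ => ?_
  rw [logDer, PowerSeries.coeff_mk, one_smul, MvPolynomial.smul_eq_C_mul, mul_assoc]

/-- The operator `∏ᵢ ∂ᵢ Xᵢ`. -/
noncomputable def shiftOp : MvPolynomial (Fin N) ℝ →ₗ[ℝ] MvPolynomial (Fin N) ℝ :=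
  (MvPolynomial.basisMonomials (Fin N) ℝ).constr ℝ
    fun a => MvPolynomial.monomial a (∏ i, ((a i : ℝ) + 1))

theorem shiftOp_monomial (a : Fin N →₀ ℕ) (r : ℝ) :
    shiftOp (MvPolynomial.monomial a r) =
      MvPolynomial.monomial a (r * ∏ i, ((a i : ℝ) + 1)) := by
  have h := (MvPolynomial.basisMonomials (Fin N) ℝ).constr_basis ℝ
    (fun a => MvPolynomial.monomial a (∏ i, ((a i : ℝ) + 1))) a
  rw [MvPolynomial.coe_basisMonomials] at h
  rw [← mul_one r, ← smul_eq_mul, ← MvPolynomial.smul_monomial, map_smul, shiftOp, h,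
    MvPolynomial.smul_monomial]
  simp

theorem wittOp_monomial (b : ℝ) (m : ℕ) (a : Fin N →₀ ℕ) (r : ℝ) :
    wittOp b m (MvPolynomial.monomial a r) =
      ∑ i, MvPolynomial.monomial (a + Finsupp.single i m) (r * (a i + b)) := by
  rw [wittOp_apply]
  refine Finset.sum_congr rfl fun i _ => ?_
  rw [MvPolynomial.X_mul_pderiv_monomial, MvPolynomial.X_pow_eq_monomial, mul_add,
    MvPolynomial.smul_monomial, MvPolynomial.smul_monomial, MvPolynomial.monomial_mul,
    MvPolynomial.monomial_mul, ← map_add, add_comm (Finsupp.single i m)]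
  congr 1
  simp
  ring

theorem wittOp_shiftOp (m : ℕ) (q : MvPolynomial (Fin N) ℝ) :
    wittOp (m + 1) m (shiftOp q) = shiftOp (wittOp 1 m q) := by
  suffices h : (wittOp (m + 1) m) ∘ₗ shiftOp = shiftOp ∘ₗ wittOp (N := N) 1 m from
    LinearMap.congr_fun h q
  refine (MvPolynomial.basisMonomials (Fin N) ℝ).ext fun a => ?_
  simp only [LinearMap.comp_apply, MvPolynomial.coe_basisMonomials]
  rw [shiftOp_monomial, wittOp_monomial, wittOp_monomial, map_sum]
  refine Finset.sum_congr rfl fun i _ => ?_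
  rw [shiftOp_monomial]
  congr 1
  rw [← Finset.mul_prod_erase Finset.univ _ (Finset.mem_univ i),
    ← Finset.mul_prod_erase Finset.univ (fun k => (((a + Finsupp.single i m) k : ℕ) : ℝ) + 1)
      (Finset.mem_univ i)]
  have : ∏ k ∈ Finset.univ.erase i, ((((a + Finsupp.single i m) k : ℕ) : ℝ) + 1) =
      ∏ k ∈ Finset.univ.erase i, ((a k : ℝ) + 1) :=
    Finset.prod_congr rfl fun k hk => by
      simp [Finsupp.single_eq_of_ne (Finset.ne_of_mem_erase hk)]
  rw [this]
  simp
  ring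

theorem shiftOp_vandermonde :
    shiftOp (vandermonde N) = (N.factorial : ℝ) • vandermonde N := by
  have hdet : vandermonde N =
      (Matrix.vandermonde (MvPolynomial.X (R := ℝ) : Fin N → _)).det :=
    (Matrix.det_vandermonde _).symm
  rw [hdet, Matrix.det_apply, map_sum, Finset.smul_sum]
  refine Finset.sum_congr rfl fun σ _ => ?_
  have hm : ∏ i, Matrix.vandermonde (MvPolynomial.X (R := ℝ) : Fin N → _) (σ i) i =
      MvPolynomial.monomial (∑ i, Finsupp.single (σ i) (i : ℕ)) 1 := by
    rw [MvPolynomial.monomial_sum_one]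
    exact Finset.prod_congr rfl fun i _ => by simp [MvPolynomial.X_pow_eq_monomial]
  rw [hm, Units.smul_def, map_zsmul, shiftOp_monomial, smul_comm (N.factorial : ℝ)]
  congr 1
  rw [MvPolynomial.smul_monomial]
  congr 1
  rw [one_mul, smul_eq_mul, mul_one, ← Equiv.prod_comp σ]
  have (i : Fin N) : (∑ k : Fin N, Finsupp.single (σ k) (k : ℕ)) (σ i) = (i : ℕ) := by
    rw [Finsupp.finsetSum_apply, Finset.sum_eq_single i]
    · simp
    · intro k _ hk
      exact Finsupp.single_eq_of_ne (fun h => hk (σ.injective h).symm)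
    · simp
  simp_rw [this]
  rw [Fin.prod_univ_eq_prod_range (fun i => (i : ℝ) + 1), ← Finset.prod_range_add_one_eq_factorial]
  push_cast
  rfl


theorem hasDerivAt_eval_update (q : MvPolynomial (Fin N) ℝ) (w : Fin N → ℝ) (i : Fin N) (t : ℝ) :
    HasDerivAt (fun s => MvPolynomial.eval (Function.update w i s) q)
      (MvPolynomial.eval (Function.update w i t) (MvPolynomial.pderiv i q)) t := by
  induction q using MvPolynomial.induction_on with
  | C a => simpa using hasDerivAt_const t a
  | add p q hp hq =>
    simp only [map_add]
    exact hp.add hq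
  | mul_X p j hp =>
    have hX : HasDerivAt (fun s => Function.update w i s j)
        (MvPolynomial.eval (Function.update w i t)
          (MvPolynomial.pderiv i (MvPolynomial.X (R := ℝ) j))) t := by
      rcases eq_or_ne j i with rfl | hj
      · simpa using hasDerivAt_id' t
      · simpa [hj, MvPolynomial.pderiv_X_of_ne hj] using hasDerivAt_const t (w j)
    simp only [map_mul, MvPolynomial.eval_X]
    refine (hp.mul hX).congr_deriv ?_
    simp [Derivation.leibniz]
    ring

/-- The inverse coordinates `1 / (xₖ - y)`. -/
noncomputable def invCoord (p : (Fin N → ℝ) × ℝ) (k : Fin N) : ℝ := (p.1 k - p.2)⁻¹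

theorem invCoord_update (p : (Fin N → ℝ) × ℝ) (i : Fin N) (t : ℝ) :
    invCoord (Function.update p.1 i t, p.2) =
      Function.update (invCoord p) i (t - p.2)⁻¹ := by
  ext k
  rcases eq_or_ne k i with rfl | hk
  · simp [invCoord]
  · simp [invCoord, hk]

theorem hasDerivAt_eval_invCoord (Q : MvPolynomial (Fin N) ℝ) (p : (Fin N → ℝ) × ℝ) (i : Fin N)
    (hi : p.1 i ≠ p.2) :
    HasDerivAt (fun t => MvPolynomial.eval (invCoord (Function.update p.1 i t, p.2)) Q)
      (-(invCoord p i) ^ 2 * MvPolynomial.eval (invCoord p) (MvPolynomial.pderiv i Q))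
      (p.1 i) := by
  have h1 : HasDerivAt (fun t : ℝ => (t - p.2)⁻¹) (-(invCoord p i) ^ 2) (p.1 i) := by
    refine (((hasDerivAt_id' (p.1 i)).sub_const p.2).inv (sub_ne_zero.mpr hi)).congr_deriv ?_
    simp [invCoord, neg_div]
  have h2 := hasDerivAt_eval_update Q (invCoord p) i (invCoord p i)
  have h3 := h2.comp (p.1 i) h1
  rw [Function.update_eq_self] at h3
  simp_rw [invCoord_update]
  rw [mul_comm]
  exact h3

/-- The product of the squares of the variables. -/
noncomputable def squares (N : ℕ) : MvPolynomial (Fin N) ℝ := ∏ k, MvPolynomial.X k ^ 2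

theorem X_mul_pderiv_squares_mul (i : Fin N) (q : MvPolynomial (Fin N) ℝ) :
    MvPolynomial.X i * MvPolynomial.pderiv i (squares N * q) =
      squares N * (MvPolynomial.X i * MvPolynomial.pderiv i q + 2 * q) := by
  have h := ((MvPolynomial.X i : MvPolynomial (Fin N) ℝ) •
    MvPolynomial.pderiv (R := ℝ) i).map_prod_of_eigen Finset.univ
      (fun k => MvPolynomial.X k ^ 2) (fun k => if k = i then 2 else 0) (by
        intro k _
        rcases eq_or_ne k i with rfl | hk
        · simp [Derivation.leibniz_pow]
          ring
        · simp [Derivation.leibniz_pow, MvPolynomial.pderiv_X_of_ne hk, hk])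
  rw [Finset.sum_ite_eq' Finset.univ i, if_pos (Finset.mem_univ i), Derivation.smul_apply,
    smul_eq_mul, ← squares] at h
  rw [Derivation.leibniz, smul_eq_mul, smul_eq_mul]
  linear_combination q * h

theorem Lop_eq_eval (m : ℕ) (f : (Fin N → ℝ) × ℝ → ℝ) (q : MvPolynomial (Fin N) ℝ)
    (hf : ∀ p : (Fin N → ℝ) × ℝ, (∀ k, p.1 k ≠ p.2) →
      f p = MvPolynomial.eval (invCoord p) (squares N * q))
    (p : (Fin N → ℝ) × ℝ) (hp : ∀ k, p.1 k ≠ p.2) :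
    Lop N m f p = MvPolynomial.eval (invCoord p) (squares N * wittOp (m + 1) m q) := by
  rw [Lop, wittOp_apply, Finset.mul_sum, map_sum, ← Finset.sum_neg_distrib]
  refine Finset.sum_congr rfl fun i _ => ?_
  have hd : deriv (fun t => f (Function.update p.1 i t, p.2)) (p.1 i) =
      -(invCoord p i) ^ 2 *
        MvPolynomial.eval (invCoord p) (MvPolynomial.pderiv i (squares N * q)) := by
    rw [← (hasDerivAt_eval_invCoord (squares N * q) p i (hp i)).deriv]
    apply Filter.EventuallyEq.deriv_eq
    filter_upwards [isOpen_ne.mem_nhds (hp i)] with t ht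
    apply hf
    intro k
    rcases eq_or_ne k i with rfl | hk
    · simpa using ht
    · simpa [hk] using hp k
  have hu : p.1 i - p.2 ≠ 0 := sub_ne_zero.mpr (hp i)
  have hw : (p.1 i - p.2) * invCoord p i = 1 := mul_inv_cancel₀ hu
  have hz : (p.1 i - p.2) ^ (-(m : ℤ)) = invCoord p i ^ m := by
    rw [zpow_neg, zpow_natCast, invCoord, inv_pow]
  have hz' : (p.1 i - p.2) ^ ((1 : ℤ) - (m : ℤ)) = (p.1 i - p.2) * invCoord p i ^ m := by
    rw [sub_eq_add_neg (1 : ℤ), zpow_add₀ hu, zpow_one, hz]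
  have hX := congrArg (MvPolynomial.eval (invCoord p)) (X_mul_pderiv_squares_mul i q)
  rw [hd, hz, hz', hf p hp]
  simp only [map_mul, map_add, map_pow, MvPolynomial.eval_X, map_ofNat,
    MvPolynomial.smul_eval] at hX ⊢
  linear_combination
    (invCoord p i ^ m * invCoord p i *
      MvPolynomial.eval (invCoord p) (MvPolynomial.pderiv i (squares N * q))) * hw +
    invCoord p i ^ m * hX

theorem foldr_Lop_eq_eval (l : List ℕ) (f : (Fin N → ℝ) × ℝ → ℝ) (q : MvPolynomial (Fin N) ℝ)
    (hf : ∀ p : (Fin N → ℝ) × ℝ, (∀ k, p.1 k ≠ p.2) →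
      f p = MvPolynomial.eval (invCoord p) (squares N * q))
    (p : (Fin N → ℝ) × ℝ) (hp : ∀ k, p.1 k ≠ p.2) :
    l.foldr (Lop N) f p = MvPolynomial.eval (invCoord p)
      (squares N * l.foldr (fun m : ℕ => wittOp (m + 1) m) q) := by
  induction l generalizing p with
  | nil => exact hf p hp
  | cons m l ih => exact Lop_eq_eval m _ _ ih p hp

theorem prod_Ioi_mul (w : Fin N → ℝ) :
    ∏ i, ∏ j ∈ Finset.Ioi i, (w i * w j) = ∏ i, w i ^ (N - 1) := by
  have h : ∏ i, ∏ j ∈ Finset.Ioi i, w j = ∏ j, ∏ _i ∈ Finset.Iio j, w j :=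
    Finset.prod_comm' (by simp)
  simp_rw [Finset.prod_mul_distrib]
  rw [h, ← Finset.prod_mul_distrib]
  refine Finset.prod_congr rfl fun i _ => ?_
  rw [Finset.prod_const, Finset.prod_const, Fin.card_Ioi, Fin.card_Iio, ← pow_add]
  congr 1
  omega

theorem exists_Zrainbow_eq_eval (N : ℕ) :
    ∃ c : ℝ, ∀ p : (Fin N → ℝ) × ℝ, (∀ k, p.1 k ≠ p.2) →
      Zrainbow N p = MvPolynomial.eval (invCoord p) (squares N * c • vandermonde N) := by
  let s : ℝ := ∏ i : Fin N, ∏ _j ∈ Finset.Ioi i, (-1 : ℝ)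
  refine ⟨1 / Real.pi ^ N * (∏ k : Fin N, ((k.1 + 1).factorial : ℝ) * (-1) ^ (N + 1)) * s, ?_⟩
  intro p hp
  have hs : s * s = 1 := by
    simp only [s, ← Finset.prod_mul_distrib, neg_mul_neg, one_mul, Finset.prod_const_one]
  have hV : MvPolynomial.eval (invCoord p) (vandermonde N) =
      s * (∏ k, invCoord p k ^ (N - 1)) * ∏ i : Fin N, ∏ j ∈ Finset.Ioi i, (p.1 j - p.1 i) := by
    rw [← prod_Ioi_mul]
    simp only [s, vandermonde, map_prod, map_sub, MvPolynomial.eval_X, ← Finset.prod_mul_distrib]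
    refine Finset.prod_congr rfl fun i _ => Finset.prod_congr rfl fun j _ => ?_
    have hi := sub_ne_zero.mpr (hp i)
    have hj := sub_ne_zero.mpr (hp j)
    simp only [invCoord]
    field_simp
    ring
  have hZ : ∏ k : Fin N, ((k.1 + 1).factorial : ℝ) / (p.2 - p.1 k) ^ (N + 1) =
      (∏ k : Fin N, ((k.1 + 1).factorial : ℝ) * (-1) ^ (N + 1)) *
        ((∏ k, invCoord p k ^ 2) * ∏ k, invCoord p k ^ (N - 1)) := by
    simp only [← Finset.prod_mul_distrib]
    refine Finset.prod_congr rfl fun k _ => ?_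
    rw [← pow_add, show 2 + (N - 1) = N + 1 by have := k.pos; omega, mul_assoc, ← mul_pow,
      div_eq_mul_inv, ← inv_pow, invCoord, neg_one_mul, ← inv_neg, neg_sub]
  rw [map_mul, MvPolynomial.smul_eval, hV, Zrainbow, hZ, squares]
  simp only [map_prod, map_pow, MvPolynomial.eval_X]
  generalize (∏ k, invCoord p k ^ 2) = A
  generalize (∏ k, invCoord p k ^ (N - 1)) = B
  generalize (∏ i : Fin N, ∏ j ∈ Finset.Ioi i, (p.1 j - p.1 i)) = D
  generalize (∏ k : Fin N, ((k.1 + 1).factorial : ℝ) * (-1) ^ (N + 1)) = E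
  linear_combination (-(1 / Real.pi ^ N * E * A * B * D)) * hs

theorem coeff_zero_genSeries : PowerSeries.coeff 0 (genSeries N) = vandermonde N := by
  simp [genSeries, map_prod, sqrtSeries, sqrtCoeff]

theorem sum_compositionSum_vandermonde (c : ℝ) :
    ∑ k ∈ Finset.range (N + 1), compositionSum (fun m : ℕ => wittOp (m + 1) m) weight
      (fun j => j * (N + 1 - j)) (c • vandermonde N) (k + 1) (N + 1) = 0 := by
  have h := sum_compositionSum (fun m : ℕ => wittOp (N := N) (m + 1) m) weight
    (fun j => (j : ℝ) * (N + 1 - j))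
    (fun j => (c / N.factorial) • shiftOp (PowerSeries.coeff j (genSeries N))) (N + 1)
    (by simp [weight]) ?_ ?_ (N + 1) (N + 1) (by omega) le_rfl le_rfl
  · rw [coeff_zero_genSeries, shiftOp_vandermonde, smul_smul,
      div_mul_cancel₀ _ (Nat.cast_ne_zero.mpr N.factorial_ne_zero)] at h
    simpa using h
  · intro j hj hjN
    have h1 : (j : ℝ) ≠ 0 := by positivity
    have h2 : (j : ℝ) < N + 1 := by exact_mod_cast hjN
    exact mul_ne_zero h1 (by linarith)
  · intro j
    simp only [map_smul, wittOp_shiftOp]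
    rw [smul_comm, ← map_smul, genSeries_recursion, map_sum, Finset.smul_sum]
    refine Finset.sum_congr rfl fun p _ => ?_
    rw [map_smul, smul_comm]

theorem prod_weight {k n : ℕ} (m : Fin k → ℕ) (hm : ∀ i, 1 ≤ m i) (hn : ∑ i, m i = n) :
    ∏ i, weight (m i) = (-2) ^ (n - k) := by
  have h : ∀ i, weight (m i) = (-2) ^ (m i - 1) := fun i => if_neg (by have := hm i; omega)
  simp_rw [h, Finset.prod_pow_eq_pow_sum]
  congr 1
  rw [Finset.sum_tsub_distrib _ fun i _ => hm i, hn]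
  simp

theorem sum_front_mul_sum_tail {k n : ℕ} (m : Fin k → ℕ) (hn : ∑ i, m i = n) (l : ℕ) :
    (∑ i ∈ Finset.univ.filter (fun i : Fin k => (i : ℕ) < l), (m i : ℝ)) *
        ∑ i ∈ Finset.univ.filter (fun i : Fin k => l ≤ (i : ℕ)), (m i : ℝ) =
      ((∑ i ∈ Finset.univ.filter (fun i : Fin k => l ≤ (i : ℕ)), m i : ℕ) : ℝ) *
        (n - (∑ i ∈ Finset.univ.filter (fun i : Fin k => l ≤ (i : ℕ)), m i : ℕ)) := by
  have h := Finset.sum_filter_add_sum_filter_not Finset.univ (fun i : Fin k => (i : ℕ) < l)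
    fun i => (m i : ℝ)
  simp only [not_lt] at h
  rw [← hn]
  push_cast
  rw [← h]
  ring

end RainbowBPZ

/-- The Benoit–Saint-Aubin BPZ PDE of order `N + 1` at the fused point `y` for the explicit
fused rainbow pure partition function (an instance of property (PDE) of Theorem 1.3 of the
paper, with the BPZ operator of equation (1.8) at central charge `c = −2`). -/
theorem stmt8 (N : ℕ) (hN : 1 ≤ N) (x : Fin N → ℝ) (y : ℝ)
    (hx : ∀ i k : Fin N, i < k → x i < x k) (hy : ∀ i, x i < y) :
    (∑ k ∈ Finset.Icc 1 (N + 1),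
      ∑ m ∈ (Finset.Nat.antidiagonalTuple k (N + 1)).filter (fun m => ∀ i, 1 ≤ m i),
        ((-2 : ℝ) ^ (N + 1 - k) * ((N.factorial : ℝ)) ^ 2 /
            ∏ l ∈ Finset.Ico 1 k,
              ((∑ i ∈ Finset.univ.filter (fun i : Fin k => (i : ℕ) < l), (m i : ℝ)) *
                ∑ i ∈ Finset.univ.filter (fun i : Fin k => l ≤ (i : ℕ)), (m i : ℝ))) *
          ((List.ofFn m).foldr (Lop N) (Zrainbow N)) (x, y)) = 0 := by
  have hp : ∀ k, (x, y).1 k ≠ (x, y).2 := fun k => (hy k).ne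
  obtain ⟨c, hc⟩ := RainbowBPZ.exists_Zrainbow_eq_eval N
  have key := congrArg (fun q => (N.factorial : ℝ) ^ 2 *
    MvPolynomial.eval (RainbowBPZ.invCoord (x, y)) (RainbowBPZ.squares N * q))
    (RainbowBPZ.sum_compositionSum_vandermonde (N := N) c)
  simp only [Finset.mul_sum, map_sum, mul_zero, map_zero] at key
  rw [← key, Finset.range_eq_Ico, Finset.sum_Ico_add'
    (fun k => (N.factorial : ℝ) ^ 2 * MvPolynomial.eval (RainbowBPZ.invCoord (x, y))
      (RainbowBPZ.squares N * compositionSum (fun m : ℕ => RainbowBPZ.wittOp (m + 1) m)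
        RainbowBPZ.weight (fun j => j * (N + 1 - j)) (c • RainbowBPZ.vandermonde N) k (N + 1)))
    0 (N + 1) 1]
  refine Finset.sum_congr (by ext; simp) fun k _ => ?_
  rw [compositionSum, Finset.mul_sum, map_sum, Finset.mul_sum]
  refine Finset.sum_subset_zero_on_sdiff (Finset.filter_subset _ _) ?_ ?_
  · intro m hm
    rw [Finset.mem_sdiff, Finset.mem_filter, not_and] at hm
    have h := hm.2 hm.1
    push Not at h
    obtain ⟨i, hi⟩ := h
    rw [Finset.prod_eq_zero (Finset.mem_univ i)
      (show RainbowBPZ.weight (m i) = 0 from if_pos (by omega))]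
    simp
  · intro m hm
    rw [Finset.mem_filter, Finset.Nat.mem_antidiagonalTuple] at hm
    rw [RainbowBPZ.foldr_Lop_eq_eval _ _ _ hc _ hp, RainbowBPZ.prod_weight m hm.2 hm.1,
      mul_smul_comm, MvPolynomial.smul_eval, Finset.prod_inv_distrib]
    simp_rw [RainbowBPZ.sum_front_mul_sum_tail m hm.1]
    push_cast
    ring
end

section
/- Let N ≥ 2 and let K : ℝ × ℝ → ℝ satisfy K(u, v) = K(v, u) for all u, v. Let β = {{a_1, b_1}, …, {a_N, b_N}} be any partition of {1, …, 2N} into two-element blocks with a_k < b_k, and define Δ_β^K(x_1, …, x_{2N}) = det( K(x_{a_k}, x_{b_ℓ}) )_{k,ℓ=1}^{N}. Then for every i ∈ {1, …, 2N − 2} and every x ∈ ℝ^{2N}: Σ_{σ} Δ_β^K(x_{σ(1)}, …, x_{σ(2N)}) = 0, where σ ranges over the six permutations of {1, …, 2N} that fix every element outside {i, i+1, i+2}. -/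
open scoped BigOperators

/-- Exchanging two of the row sites changes the sign of the determinant. -/
theorem det_kernel_swap_rows {ι α R : Type*} [Fintype ι] [DecidableEq ι] [DecidableEq α]
    [CommRing R] (F : α → α → R) {a b : ι → α} (ha : Function.Injective a)
    (hne : ∀ k ℓ, a k ≠ b ℓ) {m n : ι} (hmn : m ≠ n) :
    Matrix.det (Matrix.of fun k ℓ => F (Equiv.swap (a m) (a n) (a k))
      (Equiv.swap (a m) (a n) (b ℓ))) = -Matrix.det (Matrix.of fun k ℓ => F (a k) (b ℓ)) := by
  have h : (Matrix.of fun k ℓ => F (Equiv.swap (a m) (a n) (a k))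
      (Equiv.swap (a m) (a n) (b ℓ))) =
      (Matrix.of fun k ℓ => F (a k) (b ℓ)).submatrix (Equiv.swap m n) id := by
    ext k ℓ
    simp [ha.swap_apply, Equiv.swap_apply_of_ne_of_ne (hne m ℓ).symm (hne n ℓ).symm]
  rw [h, Matrix.det_permute, Equiv.Perm.sign_swap hmn]
  simp

/-- If two of the sites that may be permuted are row sites, the symmetrized determinant
vanishes. -/
theorem sum_perm_det_kernel_eq_zero {ι α R : Type*} [Fintype ι] [DecidableEq ι] [Fintype α]
    [DecidableEq α] [CommRing R] (F : α → α → R) {a b : ι → α} (ha : Function.Injective a)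
    (hne : ∀ k ℓ, a k ≠ b ℓ) (P : α → Prop)
    [DecidablePred fun σ : Equiv.Perm α => ∀ j, σ j ≠ j → P j]
    {m n : ι} (hmn : m ≠ n) (hm : P (a m)) (hn : P (a n)) :
    ∑ σ ∈ Finset.univ.filter (fun σ : Equiv.Perm α => ∀ j, σ j ≠ j → P j),
      Matrix.det (Matrix.of fun k ℓ => F (σ (a k)) (σ (b ℓ))) = 0 := by
  refine Finset.sum_involution (fun σ _ => σ * Equiv.swap (a m) (a n)) ?_ ?_ ?_ ?_
  · intro σ _
    have h := det_kernel_swap_rows (fun u v => F (σ u) (σ v)) ha hne hmn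
    simp only [Equiv.Perm.mul_apply]
    rw [h, add_neg_cancel]
  · intro σ _ _ h
    exact hmn (ha (Equiv.swap_eq_one_iff.mp (mul_eq_left.mp h)))
  · intro σ hσ
    simp only [Finset.mem_filter, Finset.mem_univ, true_and, Equiv.Perm.mul_apply] at hσ ⊢
    intro j hj
    by_cases h₁ : j = a m
    · exact h₁ ▸ hm
    by_cases h₂ : j = a n
    · exact h₂ ▸ hn
    rw [Equiv.swap_apply_of_ne_of_ne h₁ h₂] at hj
    exact hσ j hj
  · intro σ _
    simp [mul_assoc]

/-- If two of the sites that may be permuted are column sites, the symmetrized determinant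
vanishes. -/
theorem sum_perm_det_kernel_eq_zero_of_cols {ι α R : Type*} [Fintype ι] [DecidableEq ι]
    [Fintype α] [DecidableEq α] [CommRing R] (F : α → α → R) {a b : ι → α}
    (hb : Function.Injective b) (hne : ∀ k ℓ, a k ≠ b ℓ) (P : α → Prop)
    [DecidablePred fun σ : Equiv.Perm α => ∀ j, σ j ≠ j → P j]
    {m n : ι} (hmn : m ≠ n) (hm : P (b m)) (hn : P (b n)) :
    ∑ σ ∈ Finset.univ.filter (fun σ : Equiv.Perm α => ∀ j, σ j ≠ j → P j),
      Matrix.det (Matrix.of fun k ℓ => F (σ (a k)) (σ (b ℓ))) = 0 := by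
  rw [← sum_perm_det_kernel_eq_zero (fun u v => F v u) hb (fun k ℓ => (hne ℓ k).symm) P hmn hm hn]
  refine Finset.sum_congr rfl fun σ _ => ?_
  rw [← Matrix.det_transpose]
  rfl

/-- Proposition 5.8 of the paper (descent to the Temperley–Lieb algebra), concretely:
the symmetrizer on three consecutive sites annihilates every Fomin-type determinant
`Δ_β^K` with symmetric kernel `K`. The sum ranges over the six permutations of
`{1, …, 2N}` fixing every element outside `{i, i+1, i+2}` (here `i` is 0-based). -/
theorem stmt12 (N : ℕ) (hN : 2 ≤ N)
    (K : ℝ → ℝ → ℝ) (hK : ∀ u v, K u v = K v u)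
    (a b : Fin N → Fin (2 * N)) (hab : ∀ k, a k < b k)
    (hpart : Function.Bijective (Sum.elim a b))
    (i : ℕ) (hi : i + 2 < 2 * N)
    (x : Fin (2 * N) → ℝ) :
    ∑ σ ∈ Finset.univ.filter (fun σ : Equiv.Perm (Fin (2 * N)) =>
        ∀ j : Fin (2 * N), σ j ≠ j →
          j = (⟨i, by omega⟩ : Fin (2 * N)) ∨ j = (⟨i + 1, by omega⟩ : Fin (2 * N)) ∨
            j = (⟨i + 2, by omega⟩ : Fin (2 * N))),
      Matrix.det (Matrix.of fun k ℓ : Fin N => K (x (σ (a k))) (x (σ (b ℓ)))) = 0 := by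
  have ha : Function.Injective a := hpart.1.comp Sum.inl_injective
  have hb : Function.Injective b := hpart.1.comp Sum.inr_injective
  have hne : ∀ k ℓ, a k ≠ b ℓ := fun k ℓ h => Sum.inl_ne_inr (hpart.1 h)
  have hsite : ∀ p, (∃ k, a k = p) ∨ ∃ k, b k = p := fun p => by
    obtain ⟨k | k, h⟩ := hpart.2 p
    exacts [Or.inl ⟨k, h⟩, Or.inr ⟨k, h⟩]
  set P : Fin (2 * N) → Prop := fun j =>
    j = (⟨i, by omega⟩ : Fin (2 * N)) ∨ j = (⟨i + 1, by omega⟩ : Fin (2 * N)) ∨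
      j = (⟨i + 2, by omega⟩ : Fin (2 * N)) with hP
  have rows : ∀ m n, a m ≠ a n → P (a m) → P (a n) → _ := fun m n h =>
    sum_perm_det_kernel_eq_zero (fun u v => K (x u) (x v)) ha hne P (ne_of_apply_ne a h)
  have cols : ∀ m n, b m ≠ b n → P (b m) → P (b n) → _ := fun m n h =>
    sum_perm_det_kernel_eq_zero_of_cols (fun u v => K (x u) (x v)) hb hne P (ne_of_apply_ne b h)
  obtain ⟨k₀, h₀⟩ | ⟨k₀, h₀⟩ := hsite ⟨i, by omega⟩ <;>
  obtain ⟨k₁, h₁⟩ | ⟨k₁, h₁⟩ := hsite ⟨i + 1, by omega⟩ <;>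
  obtain ⟨k₂, h₂⟩ | ⟨k₂, h₂⟩ := hsite ⟨i + 2, by omega⟩
  · exact rows k₀ k₁ (by simp [h₀, h₁]) (by simp [hP, h₀]) (by simp [hP, h₁])
  · exact rows k₀ k₁ (by simp [h₀, h₁]) (by simp [hP, h₀]) (by simp [hP, h₁])
  · exact rows k₀ k₂ (by simp [h₀, h₂]) (by simp [hP, h₀]) (by simp [hP, h₂])
  · exact cols k₁ k₂ (by simp [h₁, h₂]) (by simp [hP, h₁]) (by simp [hP, h₂])
  · exact rows k₁ k₂ (by simp [h₁, h₂]) (by simp [hP, h₁]) (by simp [hP, h₂])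
  · exact cols k₀ k₂ (by simp [h₀, h₂]) (by simp [hP, h₀]) (by simp [hP, h₂])
  · exact cols k₀ k₁ (by simp [h₀, h₁]) (by simp [hP, h₀]) (by simp [hP, h₁])
  · exact cols k₀ k₁ (by simp [h₀, h₁]) (by simp [hP, h₀]) (by simp [hP, h₁])
end

section
/- Let d ≥ 2, let s_1, …, s_d be positive integers, fix j ∈ {1, …, d − 1} with s_{j+1} = 1, and let Ξ ∈ ℤ. Let Ω ⊂ ℝ^d be open, let W : Ω → ℝ be real-analytic, and suppose there is a point p = (x_1^0, …, x_{j−1}^0, x̂^0, x_{j+2}^0, …, x_d^0) with x_1^0 < ⋯ < x_{j−1}^0 < x̂^0 < x_{j+2}^0 < ⋯ < x_d^0, (0, p) ∈ Ω, and W(0, p) ≠ 0. Define, for those (x_1, …, x_d) with x_1 < ⋯ < x_d for which ε := x_{j+1} − x_j > 0 and (ε, x_1, …, x_{j−1}, (x_j + x_{j+1})/2, x_{j+2}, …, x_d) ∈ Ω, the function Z(x_1, …, x_d) := ε^{Ξ} · W(ε, x_1, …, x_{j−1}, (x_j + x_{j+1})/2, x_{j+2}, …, x_d). If Z satisfies on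 this domain the second-order BPZ equation ∂²Z/∂x_{j+1}² + Σ_{i ≠ j+1} ( (2/(x_i − x_{j+1})) ∂Z/∂x_i − (s_i(s_i+1)/(x_i − x_{j+1})²) Z ) = 0, then Ξ(Ξ + 1) = s_j(s_j + 1); that is, Ξ = s_j or Ξ = −(s_j + 1). -/
open scoped BigOperators

open Filter Topology

section FrobeniusForm

variable {E : Type*} [NormedAddCommGroup E] [NormedSpace ℝ E]

/-- The derivative of `ε ^ n * W` along a line, where `ε` is the first coordinate. -/
theorem hasDerivAt_fst_zpow_mul_line {W : ℝ × E → ℝ} {n : ℤ} {q v : ℝ × E} {c t : ℝ}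
    (hW : DifferentiableAt ℝ W (q + (t - c) • v)) (hq : (q + (t - c) • v).1 ≠ 0) :
    HasDerivAt (fun t => (q + (t - c) • v).1 ^ n * W (q + (t - c) • v))
      (n * v.1 * ((q + (t - c) • v).1 ^ (n - 1) * W (q + (t - c) • v)) +
        (q + (t - c) • v).1 ^ n * fderiv ℝ W (q + (t - c) • v) v) t := by
  have hline : HasDerivAt (fun t => q + (t - c) • v) v t := by
    simpa using (((hasDerivAt_id t).sub_const c).smul_const v).const_add q
  have hfst : HasDerivAt (fun t => (q + (t - c) • v).1) v.1 t := hline.fst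
  have hpow : HasDerivAt (fun t => (q + (t - c) • v).1 ^ n)
      (n * (q + (t - c) • v).1 ^ (n - 1) * v.1) t :=
    HasDerivAt.comp (h₂ := fun y : ℝ => y ^ n) t (hasDerivAt_zpow n _ (Or.inl hq)) hfst
  have hcomp : HasDerivAt (fun t => W (q + (t - c) • v)) (fderiv ℝ W (q + (t - c) • v) v) t :=
    hW.hasFDerivAt.comp_hasDerivAt t hline
  exact (hpow.mul hcomp).congr_deriv (by ring)

/-- The derivative of `ε ^ n * W` along a line at its base point. -/
theorem deriv_fst_zpow_mul_line {W : ℝ × E → ℝ} {n : ℤ} {q v : ℝ × E} {c : ℝ}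
    (hW : DifferentiableAt ℝ W q) (hq : q.1 ≠ 0) :
    deriv (fun t => (q + (t - c) • v).1 ^ n * W (q + (t - c) • v)) c =
      n * v.1 * (q.1 ^ (n - 1) * W q) + q.1 ^ n * fderiv ℝ W q v := by
  have h := hasDerivAt_fst_zpow_mul_line (W := W) (n := n) (q := q) (v := v) (c := c) (t := c)
    (by simpa using hW) (by simpa using hq)
  simpa only [sub_self, zero_smul, add_zero] using h.deriv

/-- The second derivative of `ε ^ n * W` along a line at its base point. -/
theorem deriv_deriv_fst_zpow_mul_line {W : ℝ × E → ℝ} {n : ℤ} {q v : ℝ × E} {c : ℝ}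
    (hW : ∀ᶠ p in 𝓝 q, DifferentiableAt ℝ W p)
    (hW' : DifferentiableAt ℝ (fun p => fderiv ℝ W p v) q) (hq : q.1 ≠ 0) :
    deriv (deriv (fun t => (q + (t - c) • v).1 ^ n * W (q + (t - c) • v))) c =
      n * v.1 * ((n - 1) * v.1 * (q.1 ^ (n - 2) * W q) + q.1 ^ (n - 1) * fderiv ℝ W q v) +
      (n * v.1 * (q.1 ^ (n - 1) * fderiv ℝ W q v) +
        q.1 ^ n * fderiv ℝ (fun p => fderiv ℝ W p v) q v) := by
  have hline : Tendsto (fun t : ℝ => q + (t - c) • v) (𝓝 c) (𝓝 q) :=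
    Continuous.tendsto' (by fun_prop) _ _ (by simp)
  have hne : ∀ᶠ p : ℝ × E in 𝓝 q, p.1 ≠ 0 := continuousAt_fst.eventually_ne hq
  have hderiv : deriv (fun t => (q + (t - c) • v).1 ^ n * W (q + (t - c) • v)) =ᶠ[𝓝 c]
      fun t => n * v.1 * ((q + (t - c) • v).1 ^ (n - 1) * W (q + (t - c) • v)) +
        (q + (t - c) • v).1 ^ n * fderiv ℝ W (q + (t - c) • v) v := by
    filter_upwards [hline.eventually hW, hline.eventually hne] with t h₁ h₂
    exact (hasDerivAt_fst_zpow_mul_line h₁ h₂).deriv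
  rw [hderiv.deriv_eq]
  have h₁ := hasDerivAt_fst_zpow_mul_line (W := W) (n := n - 1) (q := q) (v := v) (c := c)
    (t := c) (by simpa using hW.self_of_nhds) (by simpa using hq)
  have h₂ := hasDerivAt_fst_zpow_mul_line (W := fun p => fderiv ℝ W p v) (n := n) (q := q)
    (v := v) (c := c) (t := c) (by simpa using hW') (by simpa using hq)
  have h := ((h₁.const_mul (n * v.1)).add h₂).deriv
  simp only [sub_self, zero_smul, add_zero] at h
  refine h.trans ?_
  rw [show n - 1 - 1 = n - 2 by ring]
  push_cast
  ring

end FrobeniusForm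

/-- Lemma 4.2 of the paper (the indicial equation): suppose `Z(x_1, …, x_d)` has a Frobenius
form `ε^Ξ · W(ε, x_1, …, x_{j−1}, x̂_j, x_{j+2}, …, x_d)` with `ε = x_{j+1} − x_j`,
`x̂_j = (x_j + x_{j+1})/2`, where `W` is real-analytic on an open set `Ω` containing a point
`(0, p0)` with ordered `p0` and `W(0, p0) ≠ 0`.  If `Z` satisfies the second-order BPZ PDE at
`x_{j+1}` (which carries weight `h_{1,2} = 1`, the other points carrying weights
`s_i(s_i+1)/2`), then `Ξ = s_j` or `Ξ = −(s_j + 1)`.  Indices are 0-based: the fusing pair is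
`(x_j, x_{j+1})` with `j + 1 < d` and `s_{j+1} = 1`. -/
theorem stmt13 (d : ℕ) (hd : 2 ≤ d) (s : ℕ → ℕ) (hs : ∀ i, i < d → 0 < s i)
    (j : ℕ) (hj : j + 1 < d) (hsj : s (j + 1) = 1) (Ξ : ℤ)
    (Ω : Set (ℝ × (Fin (d - 1) → ℝ))) (hΩ : IsOpen Ω)
    (W : ℝ × (Fin (d - 1) → ℝ) → ℝ) (hW : AnalyticOnNhd ℝ W Ω)
    (red : (Fin d → ℝ) → Fin (d - 1) → ℝ)
    (hred : ∀ (x : Fin d → ℝ) (i : Fin (d - 1)),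
      red x i =
        if (i : ℕ) < j then x ⟨i, by have := i.isLt; omega⟩
        else if (i : ℕ) = j then (x ⟨j, by omega⟩ + x ⟨j + 1, hj⟩) / 2
        else x ⟨(i : ℕ) + 1, by have := i.isLt; omega⟩)
    (Z : (Fin d → ℝ) → ℝ)
    (hZ : ∀ x : Fin d → ℝ,
      Z x = (x ⟨j + 1, hj⟩ - x ⟨j, by omega⟩) ^ Ξ *
        W (x ⟨j + 1, hj⟩ - x ⟨j, by omega⟩, red x))
    (p0 : Fin (d - 1) → ℝ) (hp0 : StrictMono p0)
    (hp0Ω : ((0 : ℝ), p0) ∈ Ω) (hW0 : W (0, p0) ≠ 0)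
    (hPDE : ∀ x : Fin d → ℝ, StrictMono x →
      (x ⟨j + 1, hj⟩ - x ⟨j, by omega⟩, red x) ∈ Ω →
      deriv (deriv (fun t => Z (Function.update x ⟨j + 1, hj⟩ t))) (x ⟨j + 1, hj⟩) +
        ∑ i ∈ Finset.univ.erase (⟨j + 1, hj⟩ : Fin d),
          ((2 / (x i - x ⟨j + 1, hj⟩)) *
              deriv (fun t => Z (Function.update x i t)) (x i) -
            ((s (i : ℕ) * (s (i : ℕ) + 1) : ℕ) : ℝ) / (x i - x ⟨j + 1, hj⟩) ^ 2 * Z x) = 0) :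
    Ξ = (s j : ℤ) ∨ Ξ = -((s j : ℤ) + 1) := by
  set J : Fin d := ⟨j, by omega⟩ with hJ
  set K : Fin d := ⟨j + 1, hj⟩ with hK
  have hJK : J ≠ K := by simp [hJ, hK]
  have red_line : ∀ (x : Fin d → ℝ) (i : Fin d) (t : ℝ),
      ((Function.update x i t K - Function.update x i t J, red (Function.update x i t)) :
        ℝ × (Fin (d - 1) → ℝ)) =
      (x K - x J, red x) + (t - x i) •
        ((Pi.single i 1 : Fin d → ℝ) K - (Pi.single i 1 : Fin d → ℝ) J,
          red (Pi.single i 1)) := by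
    intro x i t
    have hupd : Function.update x i t = x + (t - x i) • (Pi.single i 1 : Fin d → ℝ) := by
      ext k
      by_cases hk : k = i
      · subst hk; simp
      · simp [hk]
    rw [hupd]
    refine Prod.ext ?_ ?_
    · simp only [Pi.add_apply, Pi.smul_apply, smul_eq_mul, Prod.fst_add, Prod.smul_fst]
      ring
    · ext k
      simp only [Pi.add_apply, Pi.smul_apply, smul_eq_mul, Prod.snd_add, Prod.smul_snd, hred]
      split_ifs <;> ring
  set v : Fin d → ℝ × (Fin (d - 1) → ℝ) := fun i =>
    ((Pi.single i 1 : Fin d → ℝ) K - (Pi.single i 1 : Fin d → ℝ) J, red (Pi.single i 1)) with hv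
  have hvK : (v K).1 = 1 := by simp [hv, hJK]
  have hvJ : (v J).1 = -1 := by simp [hv, hJK.symm]
  have Z_line : ∀ (x : Fin d → ℝ) (i : Fin d),
      (fun t => Z (Function.update x i t)) = fun t =>
        ((x K - x J, red x) + (t - x i) • v i).1 ^ Ξ * W ((x K - x J, red x) + (t - x i) • v i) := by
    intro x i
    funext t
    rw [hZ, red_line x i t]
    congr 2
    exact congrArg Prod.fst (red_line x i t)
  -- The merged index of each point, and the symmetric splitting of the fusing pair.
  obtain ⟨σ, hσ⟩ : ∃ σ : Fin d → Fin (d - 1),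
      ∀ i, (σ i : ℕ) = if (i : ℕ) ≤ j then (i : ℕ) else (i : ℕ) - 1 :=
    ⟨fun i => ⟨if (i : ℕ) ≤ j then (i : ℕ) else (i : ℕ) - 1, by
      have := i.isLt; split_ifs <;> omega⟩, fun _ => rfl⟩
  set c : Fin d → ℝ := fun i => if i = J then -(1 / 2) else if i = K then 1 / 2 else 0 with hc
  set x : ℝ → Fin d → ℝ := fun ε i => p0 (σ i) + ε * c i with hx
  have hcJ : c J = -(1 / 2) := by simp [hc]
  have hcK : c K = 1 / 2 := by simp [hc, hJK.symm]
  have hc0 : ∀ i : Fin d, (i : ℕ) ≠ j → (i : ℕ) ≠ j + 1 → c i = 0 := fun i h₁ h₂ => by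
    have h₁' : i ≠ J := fun h => h₁ (by rw [h])
    have h₂' : i ≠ K := fun h => h₂ (by rw [h])
    simp [hc, h₁', h₂']
  have hσJK : σ J = σ K := Fin.ext (by simp [hσ, hJ, hK])
  have x_sub : ∀ ε, x ε K - x ε J = ε := fun ε => by
    simp only [hx, hcJ, hcK, hσJK]; ring
  have x_red : ∀ ε, red (x ε) = p0 := fun ε => by
    ext k
    rw [hred]
    split_ifs with h₁ h₂
    · have : σ ⟨k, by have := k.isLt; omega⟩ = k := Fin.ext (by rw [hσ, if_pos]; exact h₁.le)
      simp only [hx, this]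
      rw [hc0 _ (by simpa using h₁.ne) (by simp; omega)]; ring
    · have : σ K = k := Fin.ext (by simp [hσ, hK, h₂])
      simp only [hx, hcJ, hcK, hσJK, this]; ring
    · have : σ ⟨k + 1, by have := k.isLt; omega⟩ = k :=
        Fin.ext (by rw [hσ, if_neg]; · simp
                    · simp; omega)
      simp only [hx, this]
      rw [hc0 _ (by simp; omega) (by simpa using h₂)]; ring
  have hσ_lt : ∀ i k : Fin d, i < k → ¬(i = J ∧ k = K) → σ i < σ k := by
    intro i k hik hne
    rw [Fin.lt_def] at hik ⊢
    simp only [hσ]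
    have : ¬((i : ℕ) = j ∧ (k : ℕ) = j + 1) := fun h => hne ⟨Fin.ext h.1, Fin.ext h.2⟩
    split_ifs <;> omega
  have x_tendsto : ∀ i, Tendsto (fun ε => x ε i) (𝓝[>] 0) (𝓝 (p0 (σ i))) := fun i =>
    (Continuous.tendsto' (by fun_prop) 0 _ (by simp [hx])).mono_left nhdsWithin_le_nhds
  have hpos : ∀ᶠ ε : ℝ in 𝓝[>] 0, 0 < ε := self_mem_nhdsWithin
  have x_mono : ∀ᶠ ε in 𝓝[>] (0 : ℝ), StrictMono (x ε) := by
    have : ∀ᶠ ε in 𝓝[>] (0 : ℝ), ∀ i k : Fin d, i < k → x ε i < x ε k := by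
      refine eventually_all.2 fun i => eventually_all.2 fun k => ?_
      by_cases hik : i < k
      · by_cases hne : i = J ∧ k = K
        · filter_upwards [hpos] with ε hε _
          rw [hne.1, hne.2]
          linarith [x_sub ε]
        · filter_upwards [(x_tendsto i).eventually_lt (x_tendsto k)
            (hp0 (hσ_lt i k hik hne))] with ε hε _ using hε
      · exact Eventually.of_forall fun _ h => absurd h hik
    filter_upwards [this] with ε hε i k hik using hε i k hik
  have base_tendsto : Tendsto (fun ε : ℝ => (ε, p0)) (𝓝[>] 0) (𝓝 (0, p0)) :=
    (Continuous.tendsto' (by fun_prop) 0 _ rfl).mono_left nhdsWithin_le_nhds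
  have hΩε : ∀ᶠ ε : ℝ in 𝓝[>] 0, (ε, p0) ∈ Ω := base_tendsto.eventually (hΩ.mem_nhds hp0Ω)
  have hW' : ∀ w, AnalyticOnNhd ℝ (fun p => fderiv ℝ W p w) Ω := fun w p hp =>
    ((ContinuousLinearMap.apply ℝ ℝ w).analyticAt _).comp (hW.fderiv p hp)
  have hW'' : ∀ w, AnalyticOnNhd ℝ (fun p => fderiv ℝ (fun p => fderiv ℝ W p w) p w) Ω :=
    fun w p hp => ((ContinuousLinearMap.apply ℝ ℝ w).analyticAt _).comp ((hW' w).fderiv p hp)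
  have lim_of : ∀ {f : ℝ × (Fin (d - 1) → ℝ) → ℝ}, AnalyticOnNhd ℝ f Ω →
      Tendsto (fun ε : ℝ => f (ε, p0)) (𝓝[>] 0) (𝓝 (f (0, p0))) := fun hf =>
    (hf _ hp0Ω).continuousAt.tendsto.comp base_tendsto
  have lim_id : Tendsto (fun ε : ℝ => ε) (𝓝[>] 0) (𝓝 0) := nhdsWithin_le_nhds
  -- The equation multiplied by `ε ^ (2 - Ξ)`, term by term.
  set A : ℝ → ℝ := fun ε => Ξ * (Ξ - 1) * W (ε, p0) + 2 * Ξ * (ε * fderiv ℝ W (ε, p0) (v K)) +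
    ε ^ 2 * fderiv ℝ (fun p => fderiv ℝ W p (v K)) (ε, p0) (v K) with hA
  set B : Fin d → ℝ → ℝ := fun i ε =>
    2 * (ε / (x ε i - x ε K)) * (Ξ * (v i).1 * W (ε, p0) + ε * fderiv ℝ W (ε, p0) (v i)) -
      ((s (i : ℕ) * (s (i : ℕ) + 1) : ℕ) : ℝ) * (ε / (x ε i - x ε K)) ^ 2 * W (ε, p0) with hB
  have scaled : ∀ᶠ ε in 𝓝[>] (0 : ℝ), A ε + ∑ i ∈ Finset.univ.erase K, B i ε = 0 := by
    filter_upwards [hpos, x_mono, hΩε] with ε hε hmono hmem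
    have hε0 : ε ≠ 0 := hε.ne'
    have hpt : ((x ε K - x ε J, red (x ε)) : ℝ × (Fin (d - 1) → ℝ)) = (ε, p0) := by
      rw [x_sub, x_red]
    have hpde := hPDE (x ε) hmono (by rw [hpt]; exact hmem)
    have hZε : Z (x ε) = ε ^ Ξ * W (ε, p0) := by rw [hZ, hpt, x_sub]
    simp only [Z_line, hpt, hZε] at hpde
    rw [deriv_deriv_fst_zpow_mul_line
      (by filter_upwards [hΩ.mem_nhds hmem] with p hp using (hW p hp).differentiableAt)
      ((hW' _ _ hmem).differentiableAt) hε0] at hpde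
    simp only [deriv_fst_zpow_mul_line (hW _ hmem).differentiableAt hε0] at hpde
    have h₁ : ε ^ (Ξ - 1) = ε ^ (Ξ - 2) * ε := by
      rw [← zpow_add_one₀ hε0]; congr 1; ring
    have h₂ : ε ^ Ξ = ε ^ (Ξ - 2) * ε ^ 2 := by
      rw [← zpow_natCast, ← zpow_add₀ hε0]; congr 1; push_cast; ring
    refine (mul_eq_zero.1 ?_).resolve_left (zpow_ne_zero (Ξ - 2) hε0)
    rw [← hpde, mul_add, Finset.mul_sum]
    refine congrArg₂ _ ?_ (Finset.sum_congr rfl fun i hi => ?_)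
    · simp only [hA, hvK, h₁, h₂]; ring
    · simp only [hB, h₁, h₂]
      generalize x ε i - x ε K = δ
      ring
  have lim_A : Tendsto A (𝓝[>] 0) (𝓝 (Ξ * (Ξ - 1) * W (0, p0))) := by
    have h := (((lim_of hW).const_mul ((Ξ : ℝ) * (Ξ - 1))).add
      ((lim_id.mul (lim_of (hW' (v K)))).const_mul (2 * (Ξ : ℝ)))).add
        ((lim_id.pow 2).mul (lim_of (hW'' (v K))))
    simpa using h
  have lim_B : ∀ i, ∀ r : ℝ, Tendsto (fun ε => ε / (x ε i - x ε K)) (𝓝[>] 0) (𝓝 r) →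
      Tendsto (B i) (𝓝[>] 0) (𝓝 (2 * r * (Ξ * (v i).1 * W (0, p0)) -
        ((s (i : ℕ) * (s (i : ℕ) + 1) : ℕ) : ℝ) * r ^ 2 * W (0, p0))) := by
    intro i r hr
    have h := ((hr.const_mul 2).mul (((lim_of hW).const_mul ((Ξ : ℝ) * (v i).1)).add
      (lim_id.mul (lim_of (hW' (v i)))))).sub
        (((hr.pow 2).const_mul ((s (i : ℕ) * (s (i : ℕ) + 1) : ℕ) : ℝ)).mul (lim_of hW))
    simpa only [zero_mul, add_zero] using h
  have lim_BJ : Tendsto (B J) (𝓝[>] 0) (𝓝 ((2 * Ξ - s j * (s j + 1)) * W (0, p0))) := by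
    have h := lim_B J (-1) (tendsto_const_nhds.congr' (by
      filter_upwards [hpos] with ε hε
      rw [← neg_sub (x ε K), x_sub, div_neg, div_self hε.ne']))
    convert h using 2
    rw [hvJ]
    push_cast
    ring
  have lim_B0 : ∀ i ∈ Finset.univ.erase K, i ≠ J → Tendsto (B i) (𝓝[>] 0) (𝓝 0) := by
    intro i hi hiJ
    have hiK : i ≠ K := Finset.ne_of_mem_erase hi
    have hne : p0 (σ i) - p0 (σ K) ≠ 0 := by
      rw [sub_ne_zero]
      refine hp0.injective.ne ?_
      rcases lt_or_gt_of_ne hiK with h | h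
      · exact (hσ_lt i K h fun h' => hiJ h'.1).ne
      · exact (hσ_lt K i h fun h' => hJK h'.1.symm).ne'
    have hdiv := lim_id.div ((x_tendsto i).sub (x_tendsto K)) hne
    rw [zero_div] at hdiv
    have h := lim_B i 0 hdiv
    simpa using h
  have lim_sum : Tendsto (fun ε => ∑ i ∈ Finset.univ.erase K, B i ε) (𝓝[>] 0)
      (𝓝 ((2 * Ξ - s j * (s j + 1)) * W (0, p0))) := by
    have hmem : J ∈ Finset.univ.erase K := Finset.mem_erase.2 ⟨hJK, Finset.mem_univ _⟩
    have h := lim_BJ.add (tendsto_finsetSum ((Finset.univ.erase K).erase J) fun i hi =>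
      lim_B0 i (Finset.mem_of_mem_erase hi) (Finset.ne_of_mem_erase hi))
    rw [Finset.sum_const_zero, add_zero] at h
    exact h.congr fun ε => Finset.add_sum_erase _ (fun i => B i ε) hmem
  have hlim := tendsto_nhds_unique ((lim_A.add lim_sum).congr' scaled) tendsto_const_nhds
  have hreal : ((Ξ : ℝ) - s j) * (Ξ + (s j + 1)) = 0 := by
    refine (mul_eq_zero.1 ?_).resolve_right hW0
    linear_combination hlim
  have hint : (Ξ - (s j : ℤ)) * (Ξ + ((s j : ℤ) + 1)) = 0 := by exact_mod_cast hreal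
  rcases mul_eq_zero.1 hint with h | h
  · left; omega
  · right; omega
end

section
/- Fix valences ς = (s_1, …, s_d) of positive integers with s_1 + ⋯ + s_d = 2N. For every ς-valenced link pattern α, every (x_1, …, x_d) with x_1 < ⋯ < x_d, and every Möbius map φ(u) = (a u + b)/(c u + d) with ad − bc > 0, φ'(u) = (ad − bc)/(c u + d)², c x_i + d ≠ 0 for all i, and φ(x_1) < ⋯ < φ(x_d), one has U_α(x_1, …, x_d) = ∏_{j=1}^{d} |φ'(x_j)|^{s_j(s_j+1)/2} · U_α(φ(x_1), …, φ(x_d)). -/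
open scoped BigOperators Classical

namespace UST

/-- Partial sums of the valences: `q j = s_1 + ⋯ + s_j`. -/
def q (s : ℕ → ℕ) (j : ℕ) : ℕ := ∑ i ∈ Finset.range j, s i

/-- The group (0-based) of the 0-based position `t ∈ {0, …, 2N−1}`:
the unique `j` with `q j ≤ t < q (j+1)`. -/
def grp (d : ℕ) (s : ℕ → ℕ) (t : ℕ) : ℕ :=
  ((Finset.range d).filter (fun j => q s (j + 1) ≤ t)).card

/-- The 0-based offset of position `t` within its group. -/
def off (d : ℕ) (s : ℕ → ℕ) (t : ℕ) : ℕ := t - q s (grp d s t)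

/-- A (labeled) `N`-link pattern in left-to-right orientation: `β.1 k` and `β.2 k` are the
0-based left and right endpoints of the `k`-th link; the left endpoints increase, each link
satisfies `a_k < b_k`, the links partition `{0, …, 2N−1}`, and the pattern is noncrossing. -/
def isLP (N : ℕ) (β : (Fin N → Fin (2 * N)) × (Fin N → Fin (2 * N))) : Prop :=
  (∀ k l : Fin N, k < l → β.1 k < β.1 l) ∧
    (∀ k, β.1 k < β.2 k) ∧
    Function.Bijective (Sum.elim β.1 β.2) ∧
    ∀ k l, ¬(β.1 k < β.1 l ∧ β.1 l < β.2 k ∧ β.2 k < β.2 l)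

/-- The set of `N`-link patterns. -/
noncomputable def LP (N : ℕ) : Finset ((Fin N → Fin (2 * N)) × (Fin N → Fin (2 * N))) :=
  Finset.univ.filter (isLP N)

/-- The Dyck path of a link pattern: `path β t = #{k : a_k < t} − #{k : b_k < t}`. -/
def path (N : ℕ) (β : (Fin N → Fin (2 * N)) × (Fin N → Fin (2 * N))) (t : ℕ) : ℤ :=
  ((Finset.univ.filter (fun k : Fin N => ((β.1 k : ℕ)) < t)).card : ℤ) -
    ((Finset.univ.filter (fun k : Fin N => ((β.2 k : ℕ)) < t)).card : ℤ)

/-- The relation `β ≥_ς α`: the Dyck path of `β` dominates that of `α` and they agree at the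
group boundaries `q j`. -/
def geqVal (N d : ℕ) (s : ℕ → ℕ)
    (β α : (Fin N → Fin (2 * N)) × (Fin N → Fin (2 * N))) : Prop :=
  (∀ t, t ≤ 2 * N → path N α t ≤ path N β t) ∧
    ∀ j, j ≤ d → path N β (q s j) = path N α (q s j)

/-- `ς`-valenced link patterns: link patterns with no link inside a single group. -/
def valenced (N d : ℕ) (s : ℕ → ℕ)
    (α : (Fin N → Fin (2 * N)) × (Fin N → Fin (2 * N))) : Prop :=
  isLP N α ∧ ∀ k, grp d s (α.1 k : ℕ) ≠ grp d s (α.2 k : ℕ)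

/-- The fused symmetric kernel `𝔎` at the point `x = (x_1, …, x_d)` (0-based coordinates):
`𝔎(u,v) = 0` if `u, v` lie in the same group, and otherwise, with `u` in the earlier group
`i` at 1-based offset `m_u` and `v` in the later group `j` at 1-based offset `m_v`,
`𝔎(u,v) = (−1)^{m_v − 1} (m_u + m_v − 1)! / (π (x_j − x_i)^{m_u + m_v})`, i.e. the mixed
partial derivative `∂_{x_i}^{m_u−1} ∂_{x_j}^{m_v−1}` of `1/(π (x_i − x_j)²)`. -/
noncomputable def ker (d : ℕ) (s : ℕ → ℕ) (x : ℕ → ℝ) (u v : ℕ) : ℝ :=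
  if grp d s u = grp d s v then 0
  else
    let w : ℕ × ℕ := if grp d s u < grp d s v then (u, v) else (v, u)
    ((-1 : ℝ) ^ off d s w.2 * ((off d s w.1 + off d s w.2 + 1).factorial : ℝ)) /
      (Real.pi * (x (grp d s w.2) - x (grp d s w.1)) ^ (off d s w.1 + off d s w.2 + 2))

/-- The Fomin-type determinant `Δ_β` with the fused kernel. -/
noncomputable def Δ (N d : ℕ) (s : ℕ → ℕ) (x : ℕ → ℝ)
    (β : (Fin N → Fin (2 * N)) × (Fin N → Fin (2 * N))) : ℝ :=
  Matrix.det (Matrix.of fun k ℓ : Fin N => ker d s x (β.1 k : ℕ) (β.2 ℓ : ℕ))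

/-- The explicit basis function `U_α(x) = Σ_{β ≥_ς α} Δ_β(x)` of Theorem D.2 of the paper. -/
noncomputable def U (N d : ℕ) (s : ℕ → ℕ)
    (α : (Fin N → Fin (2 * N)) × (Fin N → Fin (2 * N))) (x : ℕ → ℝ) : ℝ :=
  ∑ β ∈ (LP N).filter (fun β => geqVal N d s β α), Δ N d s x β

/-- The chamber `𝔛_d` of ordered configurations (using the first `d` coordinates). -/
def chamber (d : ℕ) (x : ℕ → ℝ) : Prop := ∀ i j : ℕ, i < j → j < d → x i < x j

end UST

namespace UST

/-! ### Transformation of the fused kernel under Möbius maps -/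

/-- Numerators of the coefficients expressing `∂^m (φ' · G ∘ φ)` through the derivatives
`(∂^p G) ∘ φ`, for a Möbius map `φ` of determinant `e` with denominator `c u + d`. -/
noncomputable def mobCoeff (e c : ℝ) : ℕ → ℕ → ℝ
  | 0, 0 => e
  | 0, _ + 1 => 0
  | m + 1, 0 => -(m + 2) * c * mobCoeff e c m 0
  | m + 1, p + 1 => -(m + p + 3) * c * mobCoeff e c m (p + 1) + e * mobCoeff e c m p

lemma mobCoeff_eq_zero (e c : ℝ) : ∀ {m p : ℕ}, m < p → mobCoeff e c m p = 0
  | 0, _ + 1, _ => by simp [mobCoeff]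
  | m + 1, p + 1, h => by
    rw [mobCoeff, mobCoeff_eq_zero e c (by lia : m < p + 1),
      mobCoeff_eq_zero e c (by lia : m < p)]
    simp

lemma mobCoeff_self (e c : ℝ) : ∀ m : ℕ, mobCoeff e c m m = e ^ (m + 1)
  | 0 => by simp [mobCoeff]
  | m + 1 => by
    rw [mobCoeff, mobCoeff_eq_zero e c (by lia : m < m + 1), mobCoeff_self e c m]
    ring

lemma hasDerivAt_mobCoeff_div (e c d x : ℝ) (hx : c * x + d ≠ 0) (m p : ℕ) :
    HasDerivAt (fun u => mobCoeff e c m p / (c * u + d) ^ (m + p + 2))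
      (-(m + p + 2) * c * mobCoeff e c m p / (c * x + d) ^ (m + p + 3)) x := by
  have h1 : HasDerivAt (fun u => c * u + d) c x := by
    simpa using ((hasDerivAt_id x).const_mul c).add_const d
  refine ((hasDerivAt_const x (mobCoeff e c m p)).fun_div (h1.fun_pow (m + p + 2))
    (pow_ne_zero _ hx)).congr_deriv ?_
  rw [div_eq_div_iff (by positivity) (by positivity)]
  push_cast
  ring

lemma hasDerivAt_mobius (a b c d x : ℝ) (hx : c * x + d ≠ 0) :
    HasDerivAt (fun u => (a * u + b) / (c * u + d)) ((a * d - b * c) / (c * x + d) ^ 2) x := by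
  have h1 : HasDerivAt (fun u => c * u + d) c x := by
    simpa using ((hasDerivAt_id x).const_mul c).add_const d
  have h2 : HasDerivAt (fun u => a * u + b) a x := by
    simpa using ((hasDerivAt_id x).const_mul a).add_const b
  refine (h2.fun_div h1 hx).congr_deriv ?_
  congr 1
  ring

/-- Higher derivatives of `φ' · (w 0 ∘ φ)`, where `w p` is the `p`-th derivative of `w 0`. -/
lemma mobius_chain (a b c d : ℝ) (k w : ℕ → ℝ → ℝ) (S : Set ℝ) (hS : IsOpen S)
    (hden : ∀ x ∈ S, c * x + d ≠ 0)
    (hk : ∀ i, ∀ x ∈ S, HasDerivAt (k i) (k (i + 1) x) x)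
    (hw : ∀ p, ∀ x ∈ S, HasDerivAt (w p) (w (p + 1) ((a * x + b) / (c * x + d)))
      ((a * x + b) / (c * x + d)))
    (h0 : ∀ x ∈ S, k 0 x =
      (a * d - b * c) / (c * x + d) ^ 2 * w 0 ((a * x + b) / (c * x + d)))
    (P i : ℕ) (hi : i < P) (x : ℝ) (hx : x ∈ S) :
    k i x = ∑ p ∈ Finset.range P, mobCoeff (a * d - b * c) c i p / (c * x + d) ^ (i + p + 2) *
      w p ((a * x + b) / (c * x + d)) := by
  induction i generalizing x with
  | zero =>
    rw [h0 x hx, Finset.sum_eq_single 0]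
    · simp [mobCoeff]
    · intro p _ hp
      rw [mobCoeff_eq_zero _ _ (Nat.pos_of_ne_zero hp)]
      simp
    · intro h
      exact absurd (Finset.mem_range.2 hi) h
  | succ i ih =>
    have hD := hden x hx
    have hsum := HasDerivAt.fun_sum (u := Finset.range P) (fun p _ =>
      (hasDerivAt_mobCoeff_div (a * d - b * c) c d x hD i p).mul
        ((hw p x hx).comp x (hasDerivAt_mobius a b c d x hD)))
    have heq : k i =ᶠ[nhds x] _ :=
      Filter.eventuallyEq_of_mem (hS.mem_nhds hx) (fun y hy => ih (by lia) y hy)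
    rw [(hk i x hx).unique (hsum.congr_of_eventuallyEq heq)]
    obtain ⟨Q, rfl⟩ : ∃ Q, P = Q + 1 := ⟨P - 1, by lia⟩
    simp only [Function.comp]
    rw [Finset.sum_add_distrib, Finset.sum_range_succ', Finset.sum_range_succ (n := Q),
      Finset.sum_range_succ', mobCoeff_eq_zero _ _ (by lia : i < Q)]
    simp only [zero_div, zero_mul, add_zero]
    rw [add_right_comm, ← Finset.sum_add_distrib]
    congr 1
    · refine Finset.sum_congr rfl fun p _ => ?_
      rw [mobCoeff]
      push_cast
      field_simp
      ring
    · rw [mobCoeff]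
      push_cast
      field_simp
      ring

/-- The mixed derivative `∂_x^i ∂_y^j` of `1 / (π (x - y)²)`. -/
noncomputable def mixedKer (i j : ℕ) (x y : ℝ) : ℝ :=
  (-1) ^ i * ((i + j + 1).factorial : ℝ) / (Real.pi * (x - y) ^ (i + j + 2))

lemma hasDerivAt_mixedKer_left (i j : ℕ) (x y : ℝ) (h : x ≠ y) :
    HasDerivAt (fun u => mixedKer i j u y) (mixedKer (i + 1) j x y) x := by
  have hxy : x - y ≠ 0 := sub_ne_zero.2 h
  have h1 : HasDerivAt (fun u => u - y) 1 x := (hasDerivAt_id x).sub_const y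
  refine ((hasDerivAt_const x ((-1) ^ i * ((i + j + 1).factorial : ℝ))).fun_div
    ((h1.fun_pow (i + j + 2)).const_mul Real.pi)
    (mul_ne_zero Real.pi_ne_zero (pow_ne_zero _ hxy))).congr_deriv ?_
  have := Real.pi_ne_zero
  simp only [mixedKer]
  rw [show i + 1 + j + 1 = (i + j + 1) + 1 by ring, Nat.factorial_succ (i + j + 1),
    show i + j + 2 - 1 = i + j + 1 by lia, show i + 1 + j + 2 = i + j + 3 by ring,
    div_eq_div_iff (by positivity) (by positivity)]
  push_cast
  ring

lemma mixedKer_comm (i j : ℕ) (x y : ℝ) : mixedKer i j x y = mixedKer j i y x := by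
  rw [mixedKer, mixedKer, add_comm j i, ← neg_sub x y, neg_pow (x - y) (i + j + 2)]
  rcases Nat.even_or_odd i with hi | hi <;> rcases Nat.even_or_odd j with hj | hj <;>
    simp [pow_add, hi.neg_one_pow, hj.neg_one_pow, neg_div, div_neg]

lemma hasDerivAt_mixedKer_right (i j : ℕ) (x y : ℝ) (h : x ≠ y) :
    HasDerivAt (fun u => mixedKer i j x u) (mixedKer i (j + 1) x y) y := by
  simp only [mixedKer_comm i _ x]
  exact hasDerivAt_mixedKer_left j i y x h.symm

lemma mobius_sub (a b c d x y : ℝ) (hx : c * x + d ≠ 0) (hy : c * y + d ≠ 0) :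
    (a * x + b) / (c * x + d) - (a * y + b) / (c * y + d) =
      (a * d - b * c) * (x - y) / ((c * x + d) * (c * y + d)) := by
  rw [div_sub_div _ _ hx hy]
  congr 1
  ring

lemma mobius_ne (a b c d x y : ℝ) (he : a * d - b * c ≠ 0) (hx : c * x + d ≠ 0)
    (hy : c * y + d ≠ 0) (h : x ≠ y) :
    (a * x + b) / (c * x + d) ≠ (a * y + b) / (c * y + d) := by
  rw [← sub_ne_zero, mobius_sub a b c d x y hx hy]
  have := sub_ne_zero.2 h
  positivity

lemma mixedKer_mobius (a b c d : ℝ) (he : a * d - b * c ≠ 0) (x y : ℝ)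
    (hx : c * x + d ≠ 0) (hy : c * y + d ≠ 0) (h : x ≠ y) (P Q i j : ℕ) (hi : i < P)
    (hj : j < Q) :
    mixedKer i j x y = ∑ p ∈ Finset.range P, ∑ r ∈ Finset.range Q,
      mobCoeff (a * d - b * c) c i p / (c * x + d) ^ (i + p + 2) *
      (mobCoeff (a * d - b * c) c j r / (c * y + d) ^ (j + r + 2)) *
      mixedKer p r ((a * x + b) / (c * x + d)) ((a * y + b) / (c * y + d)) := by
  have hopen : ∀ z : ℝ, IsOpen {u : ℝ | c * u + d ≠ 0 ∧ u ≠ z} := fun z =>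
    (isOpen_ne_fun (by fun_prop) continuous_const).inter isOpen_ne
  have hfst : ∀ z, c * z + d ≠ 0 → z ≠ x → ∀ i, i < P → mixedKer i 0 x z =
      ∑ p ∈ Finset.range P, mobCoeff (a * d - b * c) c i p / (c * x + d) ^ (i + p + 2) *
        ((a * d - b * c) / (c * z + d) ^ 2 *
        mixedKer p 0 ((a * x + b) / (c * x + d)) ((a * z + b) / (c * z + d))) := by
    intro z hz hzx i hi
    refine mobius_chain a b c d (fun i u => mixedKer i 0 u z)
      (fun p u => (a * d - b * c) / (c * z + d) ^ 2 *
        mixedKer p 0 u ((a * z + b) / (c * z + d)))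
      _ (hopen z) (fun u hu => hu.1) (fun i u hu => hasDerivAt_mixedKer_left i 0 u z hu.2)
      (fun p u hu => (hasDerivAt_mixedKer_left p 0 _ _
        (mobius_ne a b c d u z he hu.1 hz hu.2)).const_mul _) ?_ P i hi x ⟨hx, hzx.symm⟩
    intro u hu
    have h1 : c * u + d ≠ 0 := hu.1
    have h2 : u - z ≠ 0 := sub_ne_zero.2 hu.2
    have := Real.pi_ne_zero
    simp only [mixedKer]
    rw [mobius_sub a b c d u z h1 hz, div_pow, mul_pow, mul_pow]
    generalize c * u + d = m at *
    generalize c * z + d = n at *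
    generalize a * d - b * c = e at *
    field_simp
    ring
  have hsnd := mobius_chain a b c d (fun j u => mixedKer i j x u)
    (fun r u => ∑ p ∈ Finset.range P,
      mobCoeff (a * d - b * c) c i p / (c * x + d) ^ (i + p + 2) *
      mixedKer p r ((a * x + b) / (c * x + d)) u)
    _ (hopen x) (fun u hu => hu.1) (fun j u hu => hasDerivAt_mixedKer_right i j x u hu.2.symm)
    (fun r u hu => HasDerivAt.fun_sum fun p _ => (hasDerivAt_mixedKer_right p r _ _
        (mobius_ne a b c d x u he hx hu.1 hu.2.symm)).const_mul _) ?_ Q j hj y ⟨hy, h.symm⟩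
  · rw [hsnd, Finset.sum_comm]
    refine Finset.sum_congr rfl fun r _ => ?_
    rw [Finset.mul_sum]
    refine Finset.sum_congr rfl fun p _ => ?_
    ring
  · intro u hu
    rw [hfst u hu.1 hu.2 i hi, Finset.mul_sum]
    refine Finset.sum_congr rfl fun p _ => ?_
    ring

/-! ### Groups of positions -/

lemma q_mono (s : ℕ → ℕ) : Monotone (q s) :=
  monotone_nat_of_le_succ fun j => by simp [q, Finset.sum_range_succ]

lemma q_le_iff (d : ℕ) (s : ℕ → ℕ) {j : ℕ} (hj : j ≤ d) (u : ℕ) :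
    q s j ≤ u ↔ j ≤ grp d s u := by
  constructor
  · intro h
    rw [grp]
    conv_lhs => rw [← Finset.card_range j]
    refine Finset.card_le_card fun i hi => ?_
    have hi := Finset.mem_range.1 hi
    exact Finset.mem_filter.2 ⟨Finset.mem_range.2 (by lia), (q_mono s (by lia)).trans h⟩
  · intro h
    by_contra! hu
    have hsub : (Finset.range d).filter (fun j => q s (j + 1) ≤ u) ⊆ Finset.range (j - 1) := by
      intro i hi
      have hi := (Finset.mem_filter.1 hi).2
      have : i + 1 < j := (q_mono s).reflect_lt (hi.trans_lt hu)
      exact Finset.mem_range.2 (by lia)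
    have hcard := Finset.card_le_card hsub
    rw [Finset.card_range] at hcard
    rw [grp] at h
    have : j ≠ 0 := by
      rintro rfl
      simp [q] at hu
    lia

lemma lt_q_iff (d : ℕ) (s : ℕ → ℕ) {j : ℕ} (hj : j ≤ d) (u : ℕ) :
    u < q s j ↔ grp d s u < j := by
  rw [← not_le, q_le_iff d s hj, not_le]

lemma grp_q_add (d : ℕ) (s : ℕ → ℕ) {j i : ℕ} (hj : j < d) (hi : i < s j) :
    grp d s (q s j + i) = j := by
  have h1 := (q_le_iff d s hj.le (q s j + i)).1 (by lia)
  have h2 := (lt_q_iff d s hj (q s j + i)).1 (by rw [q, q, Finset.sum_range_succ]; lia)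
  lia

lemma off_q_add (d : ℕ) (s : ℕ → ℕ) {j i : ℕ} (hj : j < d) (hi : i < s j) :
    off d s (q s j + i) = i := by
  rw [off, grp_q_add d s hj hi]
  lia

lemma grp_lt (d : ℕ) (s : ℕ → ℕ) {u : ℕ} (hu : u < q s d) : grp d s u < d :=
  (lt_q_iff d s le_rfl u).1 hu

lemma q_grp_add_off (d : ℕ) (s : ℕ → ℕ) {u : ℕ} (hu : u < q s d) :
    q s (grp d s u) + off d s u = u := by
  have := (q_le_iff d s (grp_lt d s hu).le u).2 le_rfl
  rw [off]
  lia

lemma off_lt (d : ℕ) (s : ℕ → ℕ) {u : ℕ} (hu : u < q s d) : off d s u < s (grp d s u) := by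
  have h1 := (lt_q_iff d s (grp_lt d s hu) u).2 (Nat.lt_succ_self _)
  have h2 := q_grp_add_off d s hu
  rw [q, Finset.sum_range_succ, ← q] at h1
  lia

lemma prod_grp_off {M : Type*} [CommMonoid M] (d : ℕ) (s : ℕ → ℕ) (f : ℕ → ℕ → M) {n : ℕ}
    (hn : q s d = n) :
    ∏ u : Fin n, f (grp d s u) (off d s u) =
      ∏ j ∈ Finset.range d, ∏ i ∈ Finset.range (s j), f j i := by
  suffices h : ∀ m ≤ d, ∏ u ∈ Finset.range (q s m), f (grp d s u) (off d s u) =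
      ∏ j ∈ Finset.range m, ∏ i ∈ Finset.range (s j), f j i by
    rw [← h d le_rfl, hn, Finset.prod_range fun u => f (grp d s u) (off d s u)]
  intro m hm
  induction m with
  | zero => simp [q]
  | succ m ih =>
    rw [Finset.prod_range_succ, ← ih (by lia), q, Finset.sum_range_succ, ← q,
      Finset.prod_range_add]
    congr 1
    refine Finset.prod_congr rfl fun i hi => ?_
    rw [grp_q_add d s hm (Finset.mem_range.1 hi), off_q_add d s hm (Finset.mem_range.1 hi)]

lemma sum_grp_off {M : Type*} [AddCommMonoid M] (d : ℕ) (s : ℕ → ℕ) (f : ℕ → ℕ → M) {n : ℕ}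
    (hn : q s d = n) :
    ∑ u : Fin n, f (grp d s u) (off d s u) =
      ∑ j ∈ Finset.range d, ∑ i ∈ Finset.range (s j), f j i :=
  prod_grp_off (M := Multiplicative M) d s f hn

lemma sum_same_grp {n : ℕ} (d : ℕ) (s : ℕ → ℕ) (hn : q s d = n) {g : ℕ} (hg : g < d)
    (f : ℕ → ℝ) :
    ∑ u : Fin n, (if g = grp d s u then f (off d s u) else 0) =
      ∑ i ∈ Finset.range (s g), f i := by
  rw [sum_grp_off d s (fun j i => if g = j then f i else 0) hn, Finset.sum_eq_single g]
  · simp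
  · intro j _ hj
    simp [hj.symm]
  · simp [hg]

lemma ker_eq_mixedKer (d : ℕ) (s : ℕ → ℕ) (x : ℕ → ℝ) (u v : ℕ) :
    ker d s x u v = if grp d s u = grp d s v then 0 else
      mixedKer (off d s u) (off d s v) (x (grp d s u)) (x (grp d s v)) := by
  rw [ker]
  split_ifs with h1 h2
  · rfl
  · rw [mixedKer_comm, mixedKer]
    simp [add_comm]
  · rw [mixedKer, add_comm (off d s u)]

/-- The matrix transporting the kernel at `φ(x)` to the kernel at `x`. -/
noncomputable def mobMat (d : ℕ) (s : ℕ → ℕ) (x : ℕ → ℝ) (e c D : ℝ) (n : ℕ) :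
    Matrix (Fin n) (Fin n) ℝ :=
  Matrix.of fun u p => if grp d s u = grp d s p then
    mobCoeff e c (off d s u) (off d s p) /
      (c * x (grp d s u) + D) ^ (off d s u + off d s p + 2) else 0

lemma ker_mobius (d : ℕ) (s : ℕ → ℕ) (x : ℕ → ℝ) (hx : chamber d x) {n : ℕ} (hn : q s d = n)
    (A B C D : ℝ) (he : A * D - B * C ≠ 0) (hden : ∀ i, i < d → C * x i + D ≠ 0)
    (u v : Fin n) :
    ker d s x u v = ∑ p : Fin n, ∑ r : Fin n,
      mobMat d s x (A * D - B * C) C D n u p * mobMat d s x (A * D - B * C) C D n v r *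
      ker d s (fun i => (A * x i + B) / (C * x i + D)) p r := by
  have hu : grp d s u < d := grp_lt d s (by rw [hn]; exact u.2)
  have hv : grp d s v < d := grp_lt d s (by rw [hn]; exact v.2)
  simp only [ker_eq_mixedKer, mobMat, Matrix.of_apply]
  split_ifs with huv
  · symm
    refine Finset.sum_eq_zero fun p _ => Finset.sum_eq_zero fun r _ => ?_
    split_ifs <;> simp_all
  · have hxx : x (grp d s u) ≠ x (grp d s v) := by
      rcases Nat.lt_or_gt_of_ne huv with h | h
      · exact (hx _ _ h hv).ne
      · exact (hx _ _ h hu).ne'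
    rw [mixedKer_mobius A B C D he _ _ (hden _ hu) (hden _ hv) hxx _ _ _ _
      (off_lt d s (by rw [hn]; exact u.2)) (off_lt d s (by rw [hn]; exact v.2)),
      ← sum_same_grp d s hn hu]
    refine Finset.sum_congr rfl fun p _ => ?_
    split_ifs with hp
    · rw [← sum_same_grp d s hn hv]
      refine Finset.sum_congr rfl fun r _ => ?_
      split_ifs with hr hpr hpr
      · exact absurd (hp.trans (hpr.trans hr.symm)) huv
      · rw [← hp, ← hr]
      · simp
      · simp
    · simp

lemma det_mobMat (d : ℕ) (s : ℕ → ℕ) (x : ℕ → ℝ) {n : ℕ} (hn : q s d = n) (e c D : ℝ) :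
    (mobMat d s x e c D n).det =
      ∏ j ∈ Finset.range d, (e / (c * x j + D) ^ 2) ^ (s j * (s j + 1) / 2) := by
  rw [Matrix.det_of_isLowerTriangular]
  · simp only [mobMat, Matrix.of_apply, if_true, mobCoeff_self]
    rw [prod_grp_off d s (fun j i => e ^ (i + 1) / (c * x j + D) ^ (i + i + 2)) hn]
    refine Finset.prod_congr rfl fun j _ => ?_
    have : s j * (s j + 1) / 2 = ∑ i ∈ Finset.range (s j), (i + 1) := by
      have h := Finset.sum_range_id (s j + 1)
      rw [Finset.sum_range_succ'] at h
      simpa [mul_comm] using h.symm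
    rw [this, ← Finset.prod_pow_eq_pow_sum]
    refine Finset.prod_congr rfl fun i _ => ?_
    rw [div_pow, ← pow_mul]
    ring_nf
  · intro u p hup
    simp only [mobMat, Matrix.of_apply]
    split_ifs with h
    · rw [mobCoeff_eq_zero, zero_div]
      have h1 := q_grp_add_off d s (u := u) (by rw [hn]; exact u.2)
      have h2 := q_grp_add_off d s (u := p) (by rw [hn]; exact p.2)
      rw [h] at h1
      have : (u : ℕ) < p := hup
      lia
    · rfl

/-! ### Signed sums over arrangements -/

lemma sum_sign_mul_eq_det_mul {n : Type*} [Fintype n] [DecidableEq n] (T : Matrix n n ℝ)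
    (Φ : (n → n) → ℝ) :
    ∑ σ : Equiv.Perm n, (Equiv.Perm.sign σ : ℝ) * ∑ f : n → n, (∏ i, T (σ i) (f i)) * Φ f =
      T.det * ∑ σ : Equiv.Perm n, (Equiv.Perm.sign σ : ℝ) * Φ σ := by
  have hdet : ∀ f : n → n, ∑ σ : Equiv.Perm n, (Equiv.Perm.sign σ : ℝ) *
      ((∏ i, T (σ i) (f i)) * Φ f) = (T.submatrix id f).det * Φ f := by
    intro f
    rw [Matrix.det_apply', Finset.sum_mul]
    simp [mul_assoc]
  simp_rw [Finset.mul_sum]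
  rw [Finset.sum_comm]
  simp_rw [hdet]
  symm
  refine Finset.sum_of_injOn (fun σ : Equiv.Perm n => (σ : n → n)) ?_ ?_ ?_ ?_
  · exact DFunLike.coe_injective.injOn
  · simp
  · intro f _ hf
    suffices h : (T.submatrix id f).det = 0 by rw [h, zero_mul]
    have hinj : ¬ Function.Injective f := fun h => hf
      ⟨Equiv.ofBijective f (Finite.injective_iff_bijective.1 h), by simp, rfl⟩
    obtain ⟨i, j, hij, hne⟩ := by simpa [Function.Injective] using hinj
    exact Matrix.det_zero_of_column_eq hne fun k => by simp [hij]
  · intro σ _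
    rw [Matrix.det_permute']
    ring

/-- The signed sum of `∏ K(σ(e(inl k)), σ(e(inr k)))` over the arrangements `σ` whose first
halves satisfy `C`. -/
noncomputable def signedSum {ι n : Type*} [Fintype ι] [Fintype n] [DecidableEq n]
    (e : ι ⊕ ι ≃ n) (C : (ι → n) → Prop) (K : n → n → ℝ) : ℝ :=
  ∑ σ : Equiv.Perm n, (Equiv.Perm.sign σ : ℝ) *
    if C (fun k => σ (e (Sum.inl k))) then
      ∏ k, K (σ (e (Sum.inl k))) (σ (e (Sum.inr k))) else 0

lemma signedSum_congruence {ι n : Type*} [Fintype ι] [Fintype n] [DecidableEq n]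
    (e : ι ⊕ ι ≃ n) (C : (ι → n) → Prop) (K : n → n → ℝ) (T : Matrix n n ℝ)
    (hC : ∀ f g : ι → n, (∀ k, T (f k) (g k) ≠ 0) → (C f ↔ C g)) :
    signedSum e C (fun u v => ∑ p, ∑ r, T u p * T v r * K p r) =
      T.det * signedSum e C K := by
  rw [signedSum, signedSum, ← sum_sign_mul_eq_det_mul T fun f =>
    if C (fun k => f (e (Sum.inl k))) then
      ∏ k, K (f (e (Sum.inl k))) (f (e (Sum.inr k))) else 0]
  refine Finset.sum_congr rfl fun σ _ => ?_
  congr 1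
  have key : ∀ f : n → n, (∏ i, T (σ i) (f i)) * (if C (fun k => f (e (Sum.inl k))) then
      ∏ k, K (f (e (Sum.inl k))) (f (e (Sum.inr k))) else 0) =
      if C (fun k => σ (e (Sum.inl k))) then
        ∏ k, (T (σ (e (Sum.inl k))) (f (e (Sum.inl k))) *
          T (σ (e (Sum.inr k))) (f (e (Sum.inr k))) *
          K (f (e (Sum.inl k))) (f (e (Sum.inr k)))) else 0 := by
    intro f
    rw [← Equiv.prod_comp e, Fintype.prod_sum_type]
    by_cases h0 : ∀ k, T (σ (e (Sum.inl k))) (f (e (Sum.inl k))) ≠ 0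
    · simp only [hC _ _ h0, Finset.prod_mul_distrib, mul_ite, mul_zero]
    · push Not at h0
      obtain ⟨k, hk⟩ := h0
      rw [Finset.prod_eq_zero (Finset.mem_univ k) hk, zero_mul, zero_mul]
      split_ifs
      · rw [Finset.prod_eq_zero (Finset.mem_univ k)]
        rw [hk, zero_mul, zero_mul]
      · rfl
  simp_rw [key]
  split_ifs
  · simp_rw [← Fintype.sum_prod_type' (f := fun p r => T _ p * T _ r * K p r)]
    rw [Finset.prod_univ_sum, Fintype.piFinset_univ]
    refine (Fintype.sum_equiv ((Equiv.arrowCongr e.symm (Equiv.refl n)).trans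
      ((Equiv.sumArrowEquivProdArrow ι ι n).trans (Equiv.arrowProdEquivProdArrow ι (fun _ => n) fun _ => n).symm)) _ _
      fun f => ?_).symm
    rfl
  · simp

/-! ### Link patterns -/

/-- The arrangement of `Fin N ⊕ Fin N` listing the positions in consecutive pairs. -/
noncomputable def pairEquiv (N : ℕ) : Fin N ⊕ Fin N ≃ Fin (2 * N) :=
  Equiv.ofBijective
    (Sum.elim (fun k => ⟨2 * k, by lia⟩) (fun k => ⟨2 * k + 1, by lia⟩)) <| by
    rw [Fintype.bijective_iff_injective_and_card]
    refine ⟨?_, by simp [two_mul]⟩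
    rintro (k | k) (l | l) h <;> simp [Fin.ext_iff] at h ⊢ <;> lia

@[simp]
lemma pairEquiv_inl_val (N : ℕ) (k : Fin N) : (pairEquiv N (Sum.inl k) : ℕ) = 2 * k := rfl

@[simp]
lemma pairEquiv_inr_val (N : ℕ) (k : Fin N) : (pairEquiv N (Sum.inr k) : ℕ) = 2 * k + 1 := rfl

variable {N : ℕ} {a b : Fin N → Fin (2 * N)} {β : (Fin N → Fin (2 * N)) × (Fin N → Fin (2 * N))}

/-- The arrangement of the endpoints of `β` with left endpoints permuted by `π` and right
endpoints permuted by `ρ`. -/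
noncomputable def arrangement (h : Function.Bijective (Sum.elim β.1 β.2))
    (π ρ : Equiv.Perm (Fin N)) : Equiv.Perm (Fin (2 * N)) :=
  (pairEquiv N).symm.trans ((Equiv.sumCongr π ρ).trans (Equiv.ofBijective _ h))

@[simp]
lemma arrangement_inl (h : Function.Bijective (Sum.elim β.1 β.2)) (π ρ : Equiv.Perm (Fin N))
    (k : Fin N) : arrangement h π ρ (pairEquiv N (Sum.inl k)) = β.1 (π k) := by
  simp [arrangement]

@[simp]
lemma arrangement_inr (h : Function.Bijective (Sum.elim β.1 β.2)) (π ρ : Equiv.Perm (Fin N))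
    (k : Fin N) : arrangement h π ρ (pairEquiv N (Sum.inr k)) = β.2 (ρ k) := by
  simp [arrangement]

lemma isLP.sign_arrangement_one (h : isLP N β) :
    Equiv.Perm.sign (arrangement h.2.2.1 1 1) = 1 := by
  obtain ⟨h1, h2, h3, h4⟩ := h
  have hne : ∀ k l, β.1 k ≠ β.2 l := fun k l hkl => by
    have := h3.1 (a₁ := Sum.inl k) (a₂ := Sum.inr l) hkl
    simp at this
  have hne2 : ∀ k l, k ≠ l → β.2 k ≠ β.2 l := fun k l hkl hb => by
    have := h3.1 (a₁ := Sum.inr k) (a₂ := Sum.inr l) hb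
    simp_all
  rw [Equiv.Perm.sign_eq_prod_prod_Ioi]
  simp_rw [← Finset.filter_lt_eq_Ioi, Finset.prod_filter, ← Equiv.prod_comp (pairEquiv N),
    Fintype.prod_sum_type, ← Finset.prod_mul_distrib]
  refine Finset.prod_eq_one fun k _ => Finset.prod_eq_one fun l _ => ?_
  simp only [arrangement_inl, arrangement_inr, Equiv.Perm.one_apply, Fin.lt_def,
    pairEquiv_inl_val, pairEquiv_inr_val]
  rcases lt_trichotomy k l with hkl | rfl | hkl
  · have e1 := h1 k l hkl
    have e2 := h2 k
    have e3 := h2 l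
    have e4 := h4 k l
    have e5 := hne l k
    have e6 := hne2 k l hkl.ne
    simp only [Fin.lt_def, ne_eq, Fin.ext_iff] at hkl e1 e2 e3 e4 e5 e6
    have hu : (2 * k : ℕ) < 2 * l ∧ (2 * k : ℕ) < 2 * l + 1 ∧ (2 * k + 1 : ℕ) < 2 * l ∧
        (2 * k + 1 : ℕ) < 2 * l + 1 := by omega
    have e7 : (β.1 k : ℕ) < β.2 l := e1.trans e3
    simp only [hu, e1, e7, if_true]
    by_cases hc : (β.1 l : ℕ) < β.2 k
    · rw [if_neg (by omega), if_neg (by omega)]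
      rfl
    · rw [if_pos (by omega), if_pos (by omega)]
      rfl
  · have := h2 k
    simp [this]
  · rw [if_neg (by lia), if_neg (by lia), if_neg (by lia), if_neg (by lia)]
    rfl

lemma isLP.sign_arrangement (h : isLP N β) (π ρ : Equiv.Perm (Fin N)) :
    Equiv.Perm.sign (arrangement h.2.2.1 π ρ) = Equiv.Perm.sign π * Equiv.Perm.sign ρ := by
  have : arrangement h.2.2.1 π ρ =
      (((pairEquiv N).symm.trans (Equiv.sumCongr π ρ)).trans (pairEquiv N)).trans
        (arrangement h.2.2.1 1 1) := by
    ext x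
    simp [arrangement]
  rw [this, Equiv.Perm.sign_trans, Equiv.Perm.sign_symm_trans_trans, h.sign_arrangement_one,
    one_mul, Equiv.Perm.sign_sumCongr]

/-- The number of entries of `a` below `t`. -/
def cnt (a : Fin N → Fin (2 * N)) (t : ℕ) : ℕ :=
  (Finset.univ.filter fun k => (a k : ℕ) < t).card

lemma cnt_mono (a : Fin N → Fin (2 * N)) : Monotone (cnt a) := fun _ _ h =>
  Finset.card_le_card (Finset.monotone_filter_right _ fun _ _ hk => lt_of_lt_of_le hk h)

lemma cnt_two_mul (a : Fin N → Fin (2 * N)) : cnt a (2 * N) = N := by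
  rw [cnt, Finset.filter_true_of_mem fun k _ => (a k).2]
  simp

lemma cnt_succ_of_mem (ha : Function.Injective a) {t : ℕ} {k : Fin N} (hk : (a k : ℕ) = t) :
    cnt a (t + 1) = cnt a t + 1 := by
  rw [cnt, cnt, ← Finset.card_insert_of_notMem (a := k) (by simp [hk])]
  congr 1
  ext l
  have : (a l : ℕ) = a k ↔ l = k := by rw [← Fin.ext_iff, ha.eq_iff]
  simp only [Finset.mem_filter, Finset.mem_univ, true_and, Finset.mem_insert, ← this]
  lia

lemma cnt_succ_of_notMem {t : ℕ} (h : ∀ k, (a k : ℕ) ≠ t) : cnt a (t + 1) = cnt a t := by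
  rw [cnt, cnt]
  congr 1
  ext l
  have := h l
  simp only [Finset.mem_filter, Finset.mem_univ, true_and]
  lia

lemma cnt_succ_le (ha : Function.Injective a) (t : ℕ) : cnt a (t + 1) ≤ cnt a t + 1 := by
  by_cases h : ∃ k, (a k : ℕ) = t
  · obtain ⟨k, hk⟩ := h
    exact (cnt_succ_of_mem ha hk).le
  · push Not at h
    rw [cnt_succ_of_notMem h]
    lia

lemma cnt_add_le (ha : Function.Injective a) (t n : ℕ) : cnt a (t + n) ≤ cnt a t + n := by
  induction n with
  | zero => simp
  | succ n ih => exact (cnt_succ_le ha (t + n)).trans (by lia)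

lemma cnt_add_cnt (h : Function.Bijective (Sum.elim a b)) {t : ℕ} (ht : t ≤ 2 * N) :
    cnt a t + cnt b t = t := by
  simp only [cnt, Finset.card_filter]
  have hsum := h.sum_comp (fun u : Fin (2 * N) => if (u : ℕ) < t then 1 else 0)
  have hcard := Finset.card_filter (fun u : Fin (2 * N) => (u : ℕ) < t) Finset.univ
  rw [Fin.card_filter_val_lt] at hcard
  rw [Fintype.sum_sum_type, ← hcard] at hsum
  simp only [Sum.elim_inl, Sum.elim_inr] at hsum
  lia

lemma path_eq (h : isLP N β) {t : ℕ} (ht : t ≤ 2 * N) :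
    path N β t = 2 * (cnt β.1 t : ℤ) - t := by
  have := cnt_add_cnt h.2.2.1 ht
  change (cnt β.1 t : ℤ) - cnt β.2 t = _
  lia

lemma exists_first_return (ha : Function.Injective a)
    (hcnt : ∀ t, t ≤ 2 * N → t ≤ 2 * cnt a t) (k : Fin N) :
    ∃ c : Fin (2 * N), a k < c ∧
      (∀ t : ℕ, (a k : ℕ) < t → t ≤ c → 2 * (cnt a (a k) : ℤ) - (a k : ℕ) < 2 * cnt a t - t) ∧
      2 * (cnt a (c + 1) : ℤ) - (c + 1 : ℕ) = 2 * cnt a (a k) - (a k : ℕ) := by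
  have hex : ∃ t : ℕ, (a k : ℕ) < t ∧
      2 * (cnt a t : ℤ) - t ≤ 2 * cnt a (a k) - (a k : ℕ) := by
    refine ⟨2 * N, (a k).2, ?_⟩
    have := hcnt (a k) (a k).2.le
    rw [cnt_two_mul]
    push_cast
    lia
  obtain ⟨hm1, hm2⟩ := Nat.find_spec hex
  have hmin : ∀ t < Nat.find hex, (a k : ℕ) < t →
      2 * (cnt a (a k) : ℤ) - (a k : ℕ) < 2 * cnt a t - t := fun t ht h => by
    have := Nat.find_min hex ht
    lia
  have hm3 : Nat.find hex ≤ 2 * N := by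
    refine Nat.find_min' hex ⟨(a k).2, ?_⟩
    have := hcnt (a k) (a k).2.le
    rw [cnt_two_mul]
    push_cast
    lia
  generalize Nat.find hex = m at *
  obtain ⟨c, rfl⟩ : ∃ c, m = c + 1 := ⟨m - 1, by lia⟩
  have h1 := cnt_succ_of_mem ha (rfl : (a k : ℕ) = a k)
  have hck : c ≠ a k := by
    rintro rfl
    lia
  have h2 := hmin c (by lia) (by lia)
  have h3 := cnt_mono a (Nat.le_succ c)
  refine ⟨⟨c, by lia⟩, by rw [Fin.lt_def]; dsimp only; lia,
    fun t ht1 ht2 => hmin t (by dsimp only at ht2; lia) ht1, ?_⟩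
  dsimp only [Nat.succ_eq_add_one] at *
  push_cast at *
  lia

/-- A ballot sequence of left endpoints extends to a link pattern. -/
lemma exists_isLP (ha : StrictMono a) (hcnt : ∀ t, t ≤ 2 * N → t ≤ 2 * cnt a t) :
    ∃ b, isLP N (a, b) := by
  choose b hb1 hb2 hb3 using exists_first_return ha.injective hcnt
  have hab : ∀ k l, a k ≠ b l := by
    intro k l h
    have h1 := cnt_succ_of_mem ha.injective (congrArg Fin.val h)
    have h2 := hb2 l (b l) (hb1 l) le_rfl
    have h3 := hb3 l
    push_cast at *
    lia
  have hinj : ∀ k l, a k < a l → b k ≠ b l := by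
    intro k l h hkl
    have h1 := hb2 k (a l) h (by rw [hkl]; exact (hb1 l).le)
    have h2 := hb3 k
    have h3 := hb3 l
    rw [hkl] at h2
    lia
  refine ⟨b, fun k l h => ha h, hb1, ?_, ?_⟩
  · rw [Fintype.bijective_iff_injective_and_card]
    refine ⟨ha.injective.sumElim ?_ hab, by simp [two_mul]⟩
    intro k l h
    by_contra hkl
    rcases lt_or_gt_of_ne hkl with h' | h'
    · exact hinj k l (ha h') h
    · exact hinj l k (ha h') h.symm
  · rintro k l ⟨h1, h2, h3⟩
    dsimp only at h1 h2 h3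
    have h4 := hb2 k (a l) h1 h2.le
    have h5 := hb2 l (b k + 1) (Nat.lt_succ_of_lt h2) h3
    have h6 := hb3 k
    lia

lemma isLP.right_ne_of_lt {b' : Fin N → Fin (2 * N)} (h : isLP N (a, b)) (h' : isLP N (a, b'))
    {k l : Fin N} (ih : ∀ m, b m < b k → b' m = b m) (hkl : a k < a l) : b' l ≠ b k := by
  intro hlk
  have hne : b l ≠ b k := fun e => by
    have := h.2.2.1.1 (a₁ := Sum.inr l) (a₂ := Sum.inr k) e
    simp only [Sum.inr.injEq] at this
    rw [this] at hkl
    exact lt_irrefl _ hkl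
  have h1 : a l < b' l := h'.2.1 l
  rcases lt_or_gt_of_ne hne with hlt | hgt
  · have := ih l hlt
    rw [← this, hlk] at hlt
    exact lt_irrefl _ hlt
  · rw [hlk] at h1
    exact h.2.2.2 k l ⟨hkl, h1, hgt⟩

lemma isLP.exists_right_eq {b' : Fin N → Fin (2 * N)} (h : isLP N (a, b))
    (h' : isLP N (a, b')) (k : Fin N) : ∃ l, b' l = b k := by
  obtain ⟨l | l, hl⟩ := h'.2.2.1.2 (b k)
  · have := h.2.2.1.1 (a₁ := Sum.inl l) (a₂ := Sum.inr k) hl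
    simp at this
  · exact ⟨l, hl⟩

/-- A link pattern is determined by its left endpoints. -/
lemma isLP.right_unique {b' : Fin N → Fin (2 * N)} (h : isLP N (a, b)) (h' : isLP N (a, b')) :
    b = b' := by
  suffices key : ∀ p k, b k = p ↔ b' k = p from funext fun k => ((key (b k) k).1 rfl).symm
  have hinj : Function.Injective a := (show StrictMono a from fun k l => h.1 k l).injective
  have hinr : Function.Injective b := h.2.2.1.1.comp Sum.inr_injective
  have hinr' : Function.Injective b' := h'.2.2.1.1.comp Sum.inr_injective
  intro p
  induction p using WellFoundedLT.induction with
  | ind p ih =>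
    have hih : ∀ m, b m < p → b' m = b m := fun m hm => (ih _ hm m).1 rfl
    have hih' : ∀ m, b' m < p → b m = b' m := fun m hm => (ih _ hm m).2 rfl
    have main : ∀ k l, b k = p → b' l = p → k = l := by
      rintro k l rfl hl
      by_contra hkl
      rcases lt_or_gt_of_ne (hinj.ne hkl) with hlt | hgt
      · exact h.right_ne_of_lt h' hih hlt hl
      · exact h'.right_ne_of_lt h (hl ▸ hih') hgt hl.symm
    intro k
    constructor
    · intro hk
      obtain ⟨l, hl⟩ := h.exists_right_eq h' k
      rw [main k l hk (hl.trans hk), hl, hk]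
    · intro hk
      obtain ⟨l, hl⟩ := h'.exists_right_eq h k
      rw [← main l k (hl.trans hk) hk, hl, hk]

lemma isLP.left_injective (h : isLP N β) : Function.Injective β.1 :=
  h.2.2.1.1.comp Sum.inl_injective

/-- In a valenced pattern, closing endpoints precede opening endpoints within each group. -/
lemma valenced.mem_left_of_lt {d : ℕ} {s : ℕ → ℕ} (hsum : q s d = 2 * N)
    (h : valenced N d s β) (k : Fin N) (v : Fin (2 * N)) (hlt : β.1 k < v)
    (hg : grp d s (β.1 k) = grp d s v) : ∃ l, β.1 l = v := by
  obtain ⟨l | l, hl⟩ := h.1.2.2.1.2 v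
  · exact ⟨l, hl⟩
  exfalso
  have hl : β.2 l = v := hl
  subst hl
  have hmono : ∀ {x y : Fin (2 * N)}, x ≤ y → grp d s x ≤ grp d s y := fun {x y} hxy =>
    (q_le_iff d s (grp_lt d s (by rw [hsum]; exact x.2)).le _).1
      (((q_le_iff d s (grp_lt d s (by rw [hsum]; exact x.2)).le _).2 le_rfl).trans hxy)
  have h1 : β.1 l < β.1 k := by
    by_contra! hle
    have h3 := hmono hle
    have h4 := hmono (h.1.2.1 l).le
    exact h.2 l (by lia)
  have h2 : β.2 l < β.2 k := by
    by_contra! hle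
    have h3 := hmono hle
    have h4 := hmono (h.1.2.1 k).le
    exact h.2 k (by lia)
  exact h.1.2.2.2 l k ⟨h1, hlt, h2⟩

/-- A valenced pattern has the lowest path among those with the same heights at the group
boundaries. -/
lemma valenced.cnt_le {d : ℕ} {s : ℕ → ℕ} (hsum : q s d = 2 * N) (h : valenced N d s β)
    (ha : Function.Injective a) (hq : ∀ j ≤ d, cnt a (q s j) = cnt β.1 (q s j)) (t : ℕ)
    (ht : t ≤ 2 * N) : cnt β.1 t ≤ cnt a t := by
  rcases ht.eq_or_lt with rfl | ht
  · rw [cnt_two_mul, cnt_two_mul]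
  have hj : grp d s t < d := grp_lt d s (by lia)
  have h1 := (q_le_iff d s hj.le t).2 le_rfl
  have h2 := (lt_q_iff d s hj t).2 (Nat.lt_succ_self _)
  have h3 : q s (grp d s t + 1) ≤ 2 * N := hsum ▸ q_mono s hj
  by_cases hex : ∃ k, q s (grp d s t) ≤ β.1 k ∧ (β.1 k : ℕ) < t
  · obtain ⟨k, hk1, hk2⟩ := hex
    have hgk : grp d s (β.1 k) = grp d s t := by
      have h4 := (q_le_iff d s hj.le _).1 hk1
      have h5 := (lt_q_iff d s hj _).1 (hk2.trans h2)
      lia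
    have key : ∀ n, t + n ≤ q s (grp d s t + 1) → cnt β.1 (t + n) = cnt β.1 t + n := by
      intro n
      induction n with
      | zero => simp
      | succ n ih =>
        intro hn
        have hgn : grp d s (t + n) = grp d s t := by
          have h4 := (q_le_iff d s hj.le (t + n)).1 (by lia)
          have h5 := (lt_q_iff d s hj (t + n)).1 (by lia)
          lia
        obtain ⟨l, hl⟩ := h.mem_left_of_lt hsum k ⟨t + n, by lia⟩
          (by rw [Fin.lt_def]; dsimp only; lia) (hgk.trans hgn.symm)
        rw [← add_assoc, cnt_succ_of_mem h.1.left_injective (congrArg Fin.val hl), ih (by lia)]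
        rfl
    have h4 := key (q s (grp d s t + 1) - t) (by lia)
    have h5 := cnt_add_le ha t (q s (grp d s t + 1) - t)
    rw [show t + (q s (grp d s t + 1) - t) = q s (grp d s t + 1) by lia] at h4 h5
    have h6 := hq _ hj
    lia
  · push Not at hex
    refine le_trans (le_of_eq ?_) ((hq _ hj.le).symm.le.trans (cnt_mono a h1))
    rw [cnt, cnt]
    congr 1
    refine Finset.filter_congr fun k _ => ?_
    have := hex k
    lia

lemma geqVal_iff {d : ℕ} {s : ℕ → ℕ} (hsum : q s d = 2 * N)
    {α : (Fin N → Fin (2 * N)) × (Fin N → Fin (2 * N))} (hα : valenced N d s α)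
    (h : isLP N β) :
    geqVal N d s β α ↔ ∀ j ≤ d, cnt β.1 (q s j) = cnt α.1 (q s j) := by
  have hle : ∀ j ≤ d, q s j ≤ 2 * N := fun j hj => hsum ▸ q_mono s hj
  constructor
  · intro hg j hj
    have := hg.2 j hj
    rw [path_eq h (hle j hj), path_eq hα.1 (hle j hj)] at this
    lia
  · intro hc
    refine ⟨fun t ht => ?_, fun j hj => ?_⟩
    · have := hα.cnt_le hsum h.left_injective hc t ht
      rw [path_eq h ht, path_eq hα.1 ht]
      lia
    · rw [path_eq h (hle j hj), path_eq hα.1 (hle j hj), hc j hj]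

lemma cnt_comp_perm (f : Fin N → Fin (2 * N)) (π : Equiv.Perm (Fin N)) (t : ℕ) :
    cnt (fun k => f (π k)) t = cnt f t := by
  simp only [cnt, Finset.card_filter]
  exact Equiv.sum_comp π fun k => if (f k : ℕ) < t then 1 else 0

/-- Every arrangement with the prescribed counts arises from a link pattern above `α`. -/
lemma exists_arrangement {d : ℕ} {s : ℕ → ℕ} (hsum : q s d = 2 * N)
    {α : (Fin N → Fin (2 * N)) × (Fin N → Fin (2 * N))} (hα : valenced N d s α)
    (σ : Equiv.Perm (Fin (2 * N)))
    (hσ : ∀ j ≤ d, cnt (fun k => σ (pairEquiv N (Sum.inl k))) (q s j) = cnt α.1 (q s j)) :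
    ∃ β, ∃ h : isLP N β, geqVal N d s β α ∧ ∃ π ρ, arrangement h.2.2.1 π ρ = σ := by
  set f : Fin N → Fin (2 * N) := fun k => σ (pairEquiv N (Sum.inl k)) with hf
  have hfinj : Function.Injective f :=
    σ.injective.comp ((pairEquiv N).injective.comp Sum.inl_injective)
  have hmono : StrictMono (f ∘ Tuple.sort f) :=
    (Tuple.monotone_sort f).strictMono_of_injective (hfinj.comp (Tuple.sort f).injective)
  have hcnt : ∀ t, cnt (f ∘ Tuple.sort f) t = cnt f t := cnt_comp_perm f (Tuple.sort f)
  obtain ⟨b, hb⟩ := exists_isLP hmono fun t ht => by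
    rw [hcnt]
    have h1 := hα.cnt_le hsum hfinj hσ t ht
    have h2 := cnt_add_cnt hα.1.2.2.1 ht
    have h3 : cnt α.2 t ≤ cnt α.1 t := Finset.card_le_card
      (Finset.monotone_filter_right _ fun k _ hk => lt_trans (hα.1.2.1 k) hk)
    lia
  have hex : ∀ k, ∃ r, b r = σ (pairEquiv N (Sum.inr k)) := by
    intro k
    obtain ⟨l | l, hl⟩ := hb.2.2.1.2 (σ (pairEquiv N (Sum.inr k)))
    · have := (pairEquiv N).injective (σ.injective hl)
      simp at this
    · exact ⟨l, hl⟩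
  choose ρ hρ using hex
  have hρinj : Function.Injective ρ := fun k l hkl => by
    have := hρ k
    rw [hkl, hρ l] at this
    simpa using this.symm
  refine ⟨_, hb, (geqVal_iff hsum hα hb).2 fun j hj => (hcnt _).trans (hσ j hj),
    (Tuple.sort f).symm, Equiv.ofBijective ρ (Finite.injective_iff_bijective.1 hρinj), ?_⟩
  ext x : 1
  obtain ⟨k | k, rfl⟩ := (pairEquiv N).surjective x
  · simp [hf]
  · simpa using hρ k

lemma arrangement_injective {β' : (Fin N → Fin (2 * N)) × (Fin N → Fin (2 * N))}
    (h : isLP N β) (h' : isLP N β') {π ρ π' ρ' : Equiv.Perm (Fin N)}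
    (he : arrangement h.2.2.1 π ρ = arrangement h'.2.2.1 π' ρ') :
    β = β' ∧ π = π' ∧ ρ = ρ' := by
  obtain ⟨a, b⟩ := β
  obtain ⟨a', b'⟩ := β'
  have h1 : ∀ k, a (π k) = a' (π' k) := fun k => by
    simpa using DFunLike.congr_fun he (pairEquiv N (Sum.inl k))
  have h2 : ∀ k, b (ρ k) = b' (ρ' k) := fun k => by
    simpa using DFunLike.congr_fun he (pairEquiv N (Sum.inr k))
  have ha : a = a' := by
    refine (StrictMono.range_inj (fun k l => h.1 k l) (fun k l => h'.1 k l)).1 ?_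
    rw [← π.surjective.range_comp a, ← π'.surjective.range_comp a']
    exact congrArg Set.range (funext h1)
  subst ha
  obtain rfl := h.right_unique h'
  refine ⟨rfl, Equiv.ext fun k => h.left_injective (h1 k), Equiv.ext fun k => ?_⟩
  exact h.2.2.1.1.comp Sum.inr_injective (h2 k)

lemma sum_sign_perm_mul_perm {m : Type*} [Fintype m] [DecidableEq m] (M : Matrix m m ℝ) :
    ∑ π : Equiv.Perm m, ∑ ρ : Equiv.Perm m,
      ((Equiv.Perm.sign π : ℝ) * (Equiv.Perm.sign ρ : ℝ)) * ∏ k, M (π k) (ρ k) =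
      ((Fintype.card m).factorial : ℝ) * M.det := by
  have h : ∀ π : Equiv.Perm m, ∑ ρ : Equiv.Perm m,
      ((Equiv.Perm.sign π : ℝ) * (Equiv.Perm.sign ρ : ℝ)) * ∏ k, M (π k) (ρ k) = M.det := by
    intro π
    have h1 : (M.submatrix π id).det = ∑ ρ : Equiv.Perm m,
        (Equiv.Perm.sign ρ : ℝ) * ∏ k, M (π k) (ρ k) := by
      rw [← Matrix.det_transpose, Matrix.det_apply']
      rfl
    simp_rw [mul_assoc]
    rw [← Finset.mul_sum, ← h1, Matrix.det_permute, ← mul_assoc]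
    rcases Int.units_eq_one_or (Equiv.Perm.sign π) with h | h <;> simp [h]
  simp [h, Fintype.card_perm]

lemma signedSum_eq_sum_det {d : ℕ} {s : ℕ → ℕ} (hsum : q s d = 2 * N)
    {α : (Fin N → Fin (2 * N)) × (Fin N → Fin (2 * N))} (hα : valenced N d s α)
    (K : Fin (2 * N) → Fin (2 * N) → ℝ) :
    signedSum (pairEquiv N) (fun f => ∀ j ≤ d, cnt f (q s j) = cnt α.1 (q s j)) K =
      (N.factorial : ℝ) * ∑ β ∈ (LP N).filter (fun β => geqVal N d s β α),
        (Matrix.of fun k l => K (β.1 k) (β.2 l)).det := by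
  have hdet := fun β : (Fin N → Fin (2 * N)) × (Fin N → Fin (2 * N)) =>
    sum_sign_perm_mul_perm (Matrix.of fun k l => K (β.1 k) (β.2 l))
  rw [Finset.mul_sum]
  simp_rw [Fintype.card_fin] at hdet
  simp_rw [← hdet, ← Fintype.sum_prod_type', ← Finset.sum_product']
  have hmem : ∀ x ∈ (LP N).filter (fun β => geqVal N d s β α) ×ˢ
      (Finset.univ : Finset (Equiv.Perm (Fin N) × Equiv.Perm (Fin N))),
      isLP N x.1 ∧ geqVal N d s x.1 α := by
    intro x hx
    simpa [LP] using hx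
  rw [signedSum]
  simp_rw [mul_ite, mul_zero]
  rw [← Finset.sum_filter]
  symm
  refine Finset.sum_bij (fun x hx => arrangement (hmem x hx).1.2.2.1 x.2.1 x.2.2) ?_ ?_ ?_ ?_
  · intro x hx
    refine Finset.mem_filter.2 ⟨Finset.mem_univ _, fun j hj => ?_⟩
    simp only [arrangement_inl]
    rw [cnt_comp_perm]
    exact (geqVal_iff hsum hα (hmem x hx).1).1 (hmem x hx).2 j hj
  · intro x hx y hy hxy
    obtain ⟨h1, h2, h3⟩ := arrangement_injective (hmem x hx).1 (hmem y hy).1 hxy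
    exact Prod.ext h1 (Prod.ext h2 h3)
  · intro σ hσ
    obtain ⟨β, h, hg, π, ρ, he⟩ := exists_arrangement hsum hα σ (Finset.mem_filter.1 hσ).2
    exact ⟨(β, π, ρ), by simpa [LP] using ⟨h, hg⟩, he⟩
  · intro x hx
    rw [(hmem x hx).1.sign_arrangement]
    simp

end UST

/-- Property (COV) of Theorem D.2 of the paper: Möbius covariance of the explicit basis
functions `U_α`, with Kac conformal weights `h_{1,s_j+1} = s_j(s_j+1)/2` at central charge
`c = −2`. -/
theorem stmt14 (N d : ℕ) (hN : 0 < N) (hd : 0 < d) (s : ℕ → ℕ)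
    (hs : ∀ i, i < d → 0 < s i) (hsum : UST.q s d = 2 * N)
    (α : (Fin N → Fin (2 * N)) × (Fin N → Fin (2 * N)))
    (hα : UST.valenced N d s α)
    (x : ℕ → ℝ) (hx : UST.chamber d x)
    (A B C D : ℝ) (hdet : 0 < A * D - B * C)
    (hden : ∀ i, i < d → C * x i + D ≠ 0)
    (hord : ∀ i j, i < j → j < d →
      (A * x i + B) / (C * x i + D) < (A * x j + B) / (C * x j + D)) :
    UST.U N d s α x =
      (∏ j ∈ Finset.range d,
        |(A * D - B * C) / (C * x j + D) ^ 2| ^ (s j * (s j + 1) / 2)) *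
        UST.U N d s α (fun i => (A * x i + B) / (C * x i + D)) := by
  have hU : ∀ y : ℕ → ℝ, UST.signedSum (UST.pairEquiv N)
      (fun f => ∀ j ≤ d, UST.cnt f (UST.q s j) = UST.cnt α.1 (UST.q s j))
      (fun u v => UST.ker d s y u v) = (N.factorial : ℝ) * UST.U N d s α y :=
    fun y => UST.signedSum_eq_sum_det hsum hα _
  have hfac : (N.factorial : ℝ) ≠ 0 := Nat.cast_ne_zero.2 N.factorial_ne_zero
  refine mul_left_cancel₀ hfac ?_
  rw [mul_left_comm, ← hU, ← hU]
  simp_rw [UST.ker_mobius d s x hx hsum A B C D hdet.ne' hden]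
  rw [UST.signedSum_congruence, UST.det_mobMat d s x hsum]
  · congr 1
    refine Finset.prod_congr rfl fun j _ => ?_
    rw [abs_of_nonneg (by positivity)]
  · intro f g hfg
    have hgrp : ∀ k, UST.grp d s (f k) = UST.grp d s (g k) := fun k => by
      by_contra hne
      exact hfg k (if_neg hne)
    refine forall₂_congr fun j hj => ?_
    simp only [UST.cnt, UST.lt_q_iff d s hj, hgrp]
end
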